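/- arXiv:2409.03660 — 2 statements merged into one kernel-verified Lean document; each statement's English description precedes it below -/
import Mathlib

section
/- Let Ω ⊂ ℝⁿ (n ≥ 2) be a bounded domain. Suppose the exponent function p(·) satisfies 1 < p_- ≤ p_+ < ∞; fix α with 0 ≤ α < 1 if p_+ < n and 0 ≤ α < n/p_+ if p_+ ≥ n, and define q(·) pointwise by 1/q(x) = 1/p(x) − α/n; and suppose 1/p(·) is uniformly (σ/n)-continuous on Ω for some σ < 1 − α. Then there is a constant C such that for every Lipschitz function f with compact support contained in Ω, ‖f‖_{L^{q(·)}(Ω)} ≤ C ‖∇f‖_{L^{p(·)}(Ω)}. -/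
open MeasureTheory Metric Set Filter Topology

noncomputable section

abbrev Eucl (n : ℕ) : Type := EuclideanSpace ℝ (Fin n)

/-- Essential supremum of `p` over the set `A` (w.r.t. Lebesgue measure). -/
def essSupOn {n : ℕ} (p : Eucl n → ℝ) (A : Set (Eucl n)) : ℝ :=
  essSup p (volume.restrict A)

/-- Essential infimum of `p` over the set `A` (w.r.t. Lebesgue measure). -/
def essInfOn {n : ℕ} (p : Eucl n → ℝ) (A : Set (Eucl n)) : ℝ :=
  essInf p (volume.restrict A)

/-- The Luxemburg norm of `f` on `A` with variable exponent `p`. -/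
def luxNorm {n : ℕ} (A : Set (Eucl n)) (p f : Eucl n → ℝ) : ℝ :=
  sInf {l : ℝ | 0 < l ∧ (∫⁻ x in A, ENNReal.ofReal ((|f x| / l) ^ (p x))) ≤ 1}

/-- `f` belongs to the variable Lebesgue space `L^{p(·)}(A)`. -/
def MemVarLp {n : ℕ} (A : Set (Eucl n)) (p f : Eucl n → ℝ) : Prop :=
  ∃ l : ℝ, 0 < l ∧ (∫⁻ x in A, ENNReal.ofReal ((|f x| / l) ^ (p x))) ≤ 1

/-- `d(x) = dist(x, ∂Ω)`. -/
def bdist {n : ℕ} (Ω : Set (Eucl n)) (x : Eucl n) : ℝ :=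
  infDist x (frontier Ω)

/-- The ball `B_{x,τ} = B(x, τ d(x))`. -/
def ballB {n : ℕ} (Ω : Set (Eucl n)) (τ : ℝ) (x : Eucl n) : Set (Eucl n) :=
  ball x (τ * bdist Ω x)

/-- The boundary log-Hölder condition `∂LH₀^τ(Ω)` with constant `C₀`. -/
def BoundaryLH {n : ℕ} (Ω : Set (Eucl n)) (p : Eucl n → ℝ) (τ C₀ : ℝ) : Prop :=
  ∀ x ∈ Ω, τ * bdist Ω x ≤ 1 / 2 →
    essSupOn p (ballB Ω τ x ∩ Ω) - essInfOn p (ballB Ω τ x ∩ Ω)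
      ≤ C₀ / (-Real.log (τ * bdist Ω x))

/-- `Ω` is a John domain with parameter `lam`. -/
def JohnDomain {n : ℕ} (Ω : Set (Eucl n)) (lam : ℝ) : Prop :=
  ∃ x₀ ∈ Ω, ∀ y ∈ Ω, ∃ ℓ : ℝ, 0 ≤ ℓ ∧ ∃ γ : ℝ → Eucl n,
    γ 0 = y ∧ γ ℓ = x₀ ∧ (∀ t ∈ Icc (0:ℝ) ℓ, γ t ∈ Ω) ∧
    LipschitzOnWith 1 γ (Icc (0:ℝ) ℓ) ∧
    ∀ t ∈ Icc (0:ℝ) ℓ, t ≤ lam * infDist (γ t) (frontier Ω)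

/-- `g` is uniformly `ε`-continuous on `S`. -/
def UnifEpsCont {n : ℕ} (S : Set (Eucl n)) (g : Eucl n → ℝ) (ε : ℝ) : Prop :=
  ∃ δ : ℝ, 0 < δ ∧ ∀ x ∈ S, ∀ y ∈ S, dist x y < δ → |g y - g x| < ε

/-- `f` is locally Lipschitz on `S`. -/
def LocLipschitzOn {n : ℕ} (S : Set (Eucl n)) (f : Eucl n → ℝ) : Prop :=
  ∀ x ∈ S, ∃ K : NNReal, ∃ t ∈ 𝓝 x, LipschitzOnWith K f (t ∩ S)

/-- The average of `f` over `A`. -/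
def avgOn {n : ℕ} (A : Set (Eucl n)) (f : Eucl n → ℝ) : ℝ :=
  (volume A).toReal⁻¹ * ∫ x in A, f x

/-- The pointwise dual (conjugate) exponent `p'`, `1/p + 1/p' = 1`. -/
def dualExp {α : Type*} (p : α → ℝ) : α → ℝ :=
  fun x => p x / (p x - 1)

/-- The norm of the a.e.-defined gradient of `f`. -/
def gradNorm {n : ℕ} (f : Eucl n → ℝ) : Eucl n → ℝ :=
  fun x => ‖fderiv ℝ f x‖

open scoped ENNReal NNReal

/-- Hölder's inequality, in the form of a bound for a power of a weighted integral. -/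
theorem rpow_lintegral_mul_le {X : Type*} [MeasurableSpace X] (μ : Measure X) {Q : ℝ} (hQ : 1 < Q)
    {w G : X → ℝ≥0∞} (hw : Measurable w) (hG : Measurable G) :
    (∫⁻ x, w x * G x ∂μ) ^ Q
      ≤ (∫⁻ x, w x ^ (Q / (Q - 1)) ∂μ) ^ (Q - 1) * ∫⁻ x, G x ^ Q ∂μ := by
  have hc : (Q / (Q - 1)).HolderConjugate Q := (Real.HolderConjugate.conjExponent hQ).symm
  have h := ENNReal.lintegral_mul_le_Lp_mul_Lq μ hc hw.aemeasurable hG.aemeasurable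
  have hQ0 : 0 < Q := by linarith
  have hQ1 : Q - 1 ≠ 0 := by linarith
  refine (ENNReal.rpow_le_rpow h hQ0.le).trans_eq ?_
  rw [ENNReal.mul_rpow_of_nonneg _ _ hQ0.le, ← ENNReal.rpow_mul, ← ENNReal.rpow_mul]
  congr 1
  · congr 1
    field_simp
  · rw [one_div_mul_cancel hQ0.ne', ENNReal.rpow_one]

theorem rpow_lintegral_le {X : Type*} [MeasurableSpace X] (μ : Measure X) {P : ℝ} (hP : 1 ≤ P)
    {G : X → ℝ≥0∞} (hG : Measurable G) :
    (∫⁻ x, G x ∂μ) ^ P ≤ μ univ ^ (P - 1) * ∫⁻ x, G x ^ P ∂μ := by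
  rcases hP.eq_or_lt with rfl | hP
  · simp
  · simpa using rpow_lintegral_mul_le μ hP (w := fun _ => 1) measurable_const hG

theorem lintegral_Ioo_rpow_ne_top {r s : ℝ} (hr : 0 < r) (hs : -1 < s) :
    ∫⁻ t in Ioo 0 r, ENNReal.ofReal t ^ s ≠ ∞ := by
  have h := ((intervalIntegral.integrableOn_Ioo_rpow_iff hr).2 hs).lintegral_lt_top
  refine ne_of_lt (lt_of_eq_of_lt (setLIntegral_congr_fun measurableSet_Ioo fun t ht => ?_) h)
  exact ENNReal.ofReal_rpow_of_pos ht.1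

theorem volume_ball_eq {n : ℕ} (hn : n ≠ 0) (x : Eucl n) {t : ℝ} (ht : 0 ≤ t) :
    volume (ball x t) = ENNReal.ofReal t ^ (n : ℝ) * volume (ball (0 : Eucl n) 1) := by
  have : Nonempty (Fin n) := ⟨⟨0, Nat.pos_of_ne_zero hn⟩⟩
  rw [Measure.addHaar_ball volume x ht, finrank_euclideanSpace_fin, ENNReal.ofReal_pow ht,
    ENNReal.rpow_natCast]

theorem lintegral_ball_eq_indicator {n : ℕ} (G : Eucl n → ℝ≥0∞) (x : Eucl n) (t : ℝ) :
    ∫⁻ y in ball x t, G y = ∫⁻ y, {z : Eucl n | dist z x < t}.indicator G y := by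
  rw [lintegral_indicator (measurableSet_lt (by fun_prop) (by fun_prop))]
  rfl

theorem measurable_lintegral_ball {n : ℕ} {G : Eucl n → ℝ≥0∞} (hG : Measurable G) :
    Measurable fun z : Eucl n × ℝ => ∫⁻ y in ball z.1 z.2, G y := by
  simp_rw [lintegral_ball_eq_indicator]
  have hs : MeasurableSet {w : (Eucl n × ℝ) × Eucl n | dist w.2 w.1.1 < w.1.2} :=
    measurableSet_lt (by fun_prop) (by fun_prop)
  exact ((hG.comp measurable_snd).indicator hs).lintegral_prod_right'

theorem measurable_lintegral_ball_center {n : ℕ} {G : Eucl n → ℝ≥0∞} (hG : Measurable G) (t : ℝ) :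
    Measurable fun x => ∫⁻ y in ball x t, G y := by
  have h := (measurable_lintegral_ball hG).comp (measurable_prodMk_right (y := t))
  simpa only [Function.comp_def] using h

theorem measurable_rpow_mul_lintegral_ball {n : ℕ} {G : Eucl n → ℝ≥0∞} (hG : Measurable G) (s : ℝ) :
    Measurable fun z : Eucl n × ℝ => ENNReal.ofReal z.2 ^ s * ∫⁻ y in ball z.1 z.2, G y := by
  have h := measurable_lintegral_ball hG
  fun_prop

theorem lintegral_lintegral_ball {n : ℕ} (hn : n ≠ 0) {G : Eucl n → ℝ≥0∞} (hG : Measurable G)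
    {t : ℝ} (ht : 0 ≤ t) :
    ∫⁻ x, ∫⁻ y in ball x t, G y
      = ENNReal.ofReal t ^ (n : ℝ) * volume (ball (0 : Eucl n) 1) * ∫⁻ y, G y := by
  simp_rw [lintegral_ball_eq_indicator]
  have hs : MeasurableSet {w : Eucl n × Eucl n | dist w.2 w.1 < t} :=
    measurableSet_lt (by fun_prop) (by fun_prop)
  rw [lintegral_lintegral_swap
    (f := fun x y => {z : Eucl n | dist z x < t}.indicator G y)
    ((hG.comp measurable_snd).indicator hs).aemeasurable]
  rw [← lintegral_const_mul _ hG]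
  refine lintegral_congr fun y => ?_
  rw [← volume_ball_eq hn y ht, mul_comm, ← lintegral_indicator_const measurableSet_ball]
  refine lintegral_congr fun x => ?_
  by_cases h : dist y x < t
  · rw [indicator_of_mem (show y ∈ {z | dist z x < t} from h),
      indicator_of_mem (by rwa [mem_ball, dist_comm])]
  · rw [indicator_of_notMem (show y ∉ {z | dist z x < t} from h),
      indicator_of_notMem (by rwa [mem_ball, dist_comm])]

/-- The truncated Riesz potential of order one of `G`, written as an integral over radii. -/
def radialPotential {n : ℕ} (r : ℝ) (G : Eucl n → ℝ≥0∞) (x : Eucl n) : ℝ≥0∞ :=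
  ∫⁻ t in Ioo 0 r, ENNReal.ofReal t ^ (-(n : ℝ)) * ∫⁻ y in ball x t, G y

theorem measurable_radialPotential {n : ℕ} (r : ℝ) {G : Eucl n → ℝ≥0∞} (hG : Measurable G) :
    Measurable (radialPotential r G) := by
  unfold radialPotential
  exact (measurable_rpow_mul_lintegral_ball hG (-(n : ℝ))).lintegral_prod_right'

theorem lintegral_radialPotential {n : ℕ} (hn : n ≠ 0) {r : ℝ} {G : Eucl n → ℝ≥0∞}
    (hG : Measurable G) :
    ∫⁻ x, radialPotential r G x
      = ENNReal.ofReal r * (volume (ball (0 : Eucl n) 1) * ∫⁻ y, G y) := by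
  unfold radialPotential
  rw [lintegral_lintegral_swap]
  · calc _ = ∫⁻ t in Ioo 0 r, volume (ball (0 : Eucl n) 1) * ∫⁻ y, G y := by
          refine setLIntegral_congr_fun measurableSet_Ioo fun t ht => ?_
          have h0 : ENNReal.ofReal t ≠ 0 := by simpa using ht.1
          rw [lintegral_const_mul _ (measurable_lintegral_ball_center hG t),
            lintegral_lintegral_ball hn hG ht.1.le, ← mul_assoc, ← mul_assoc,
            ← ENNReal.rpow_add _ _ h0 ENNReal.ofReal_ne_top]
          simp
      _ = _ := by
          rw [setLIntegral_const, Real.volume_Ioo, sub_zero, mul_comm]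
  · exact (measurable_rpow_mul_lintegral_ball hG (-(n : ℝ))).aemeasurable

theorem lintegral_rpow_lintegral_ball_le {n : ℕ} (hn : n ≠ 0) {P Q : ℝ} (hP : 1 ≤ P) (hPQ : P ≤ Q)
    {G : Eucl n → ℝ≥0∞} (hG : Measurable G) {M : ℝ≥0∞} (hM : ∫⁻ y, G y ^ P ≤ M) {t : ℝ}
    (ht : 0 < t) :
    ∫⁻ x, (∫⁻ y in ball x t, G y) ^ Q
      ≤ (ENNReal.ofReal t ^ (n : ℝ) * volume (ball (0 : Eucl n) 1)) ^ (Q - Q / P + 1)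
        * M ^ (Q / P) := by
  have hP0 : 0 < P := by linarith
  have hQP : 1 ≤ Q / P := (one_le_div hP0).2 hPQ
  set V := ENNReal.ofReal t ^ (n : ℝ) * volume (ball (0 : Eucl n) 1) with hV
  have hVx : ∀ x : Eucl n, volume (ball x t) = V := fun x => volume_ball_eq hn x ht.le
  have hV0 : V ≠ 0 := by
    rw [← hVx 0]; exact (measure_ball_pos _ _ ht).ne'
  have hVt : V ≠ ∞ := by
    rw [← hVx 0]; exact measure_ball_lt_top.ne
  have key : ∀ x : Eucl n, (∫⁻ y in ball x t, G y) ^ Q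
      ≤ V ^ (Q - Q / P) * M ^ (Q / P - 1) * ∫⁻ y in ball x t, G y ^ P := by
    intro x
    have h1 := rpow_lintegral_le (volume.restrict (ball x t)) hP hG
    rw [Measure.restrict_apply_univ, hVx] at h1
    have h2 : ∫⁻ y in ball x t, G y ^ P ≤ M := (setLIntegral_le_lintegral _ _).trans hM
    calc (∫⁻ y in ball x t, G y) ^ Q = ((∫⁻ y in ball x t, G y) ^ P) ^ (Q / P) := by
          rw [← ENNReal.rpow_mul, mul_div_cancel₀ _ hP0.ne']
      _ ≤ (V ^ (P - 1) * ∫⁻ y in ball x t, G y ^ P) ^ (Q / P) := by gcongr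
      _ = V ^ (Q - Q / P) * (∫⁻ y in ball x t, G y ^ P) ^ (Q / P - 1 + 1) := by
          rw [ENNReal.mul_rpow_of_nonneg _ _ (by linarith), ← ENNReal.rpow_mul]
          congr 2
          · field_simp
          · ring
      _ = V ^ (Q - Q / P) * ((∫⁻ y in ball x t, G y ^ P) ^ (Q / P - 1)
            * ∫⁻ y in ball x t, G y ^ P) := by
          rw [ENNReal.rpow_add_of_nonneg _ _ (by linarith) zero_le_one, ENNReal.rpow_one]
      _ ≤ V ^ (Q - Q / P) * (M ^ (Q / P - 1) * ∫⁻ y in ball x t, G y ^ P) := by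
          gcongr
      _ = _ := by rw [mul_assoc]
  have hGP : Measurable fun y => G y ^ P := hG.pow_const P
  calc _ ≤ ∫⁻ x, V ^ (Q - Q / P) * M ^ (Q / P - 1) * ∫⁻ y in ball x t, G y ^ P :=
        lintegral_mono key
    _ = V ^ (Q - Q / P) * M ^ (Q / P - 1) * (V * ∫⁻ y, G y ^ P) := by
        rw [lintegral_const_mul _ (measurable_lintegral_ball_center hGP t),
          lintegral_lintegral_ball hn hGP ht.le]
    _ ≤ V ^ (Q - Q / P) * M ^ (Q / P - 1) * (V * M) := by gcongr
    _ = (V ^ (Q - Q / P) * V ^ (1 : ℝ)) * (M ^ (Q / P - 1) * M ^ (1 : ℝ)) := by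
        rw [ENNReal.rpow_one, ENNReal.rpow_one]; ring
    _ = _ := by
        rw [← ENNReal.rpow_add _ _ hV0 hVt,
          ← ENNReal.rpow_add_of_nonneg _ _ (by linarith) zero_le_one, sub_add_cancel]

/-- Strictly below the Sobolev exponent, the potential maps bounded sets of `L^P` to bounded sets
of `L^Q`. -/
theorem exists_lintegral_radialPotential_rpow_le {n : ℕ} (hn : n ≠ 0) {P Q : ℝ} (hP : 1 ≤ P)
    (hPQ : P < Q) (hκ : 1 / P - 1 / Q < 1 / n) {r : ℝ} (hr : 0 < r) {M : ℝ≥0∞} (hM : M ≠ ∞) :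
    ∃ C : ℝ≥0∞, C ≠ ∞ ∧ ∀ G : Eucl n → ℝ≥0∞, Measurable G → ∫⁻ y, G y ^ P ≤ M →
      ∫⁻ x, radialPotential r G x ^ Q ≤ C := by
  have hP0 : 0 < P := by linarith
  have hQ1 : 1 < Q := by linarith
  have hQ0 : 0 < Q := by linarith
  have hn0 : (0 : ℝ) < n := by exact_mod_cast Nat.pos_of_ne_zero hn
  have hκ1 : n * (1 / P - 1 / Q) < 1 := by
    calc n * (1 / P - 1 / Q) < n * (1 / n) := by gcongr
      _ = 1 := by field_simp
  obtain ⟨β, hβ1, hβ2⟩ : ∃ β : ℝ, n * (1 / P - 1 / Q) - 1 / Q < β ∧ β < 1 - 1 / Q :=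
    exists_between (by linarith)
  set ω := volume (ball (0 : Eucl n) 1)
  have hω : ω ≠ ∞ := measure_ball_lt_top.ne
  set A := ∫⁻ t in Ioo 0 r, (ENNReal.ofReal t ^ (-β)) ^ (Q / (Q - 1)) with hA
  have hAt : A ≠ ∞ := by
    simp_rw [hA, ← ENNReal.rpow_mul]
    refine lintegral_Ioo_rpow_ne_top hr ?_
    have : β * (Q / (Q - 1)) < (1 - 1 / Q) * (Q / (Q - 1)) := by
      have : 0 < Q / (Q - 1) := div_pos hQ0 (by linarith)
      gcongr
    have h2 : (1 - 1 / Q) * (Q / (Q - 1)) = 1 := by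
      have : Q - 1 ≠ 0 := by linarith
      field_simp
    linarith
  set s := (β - n) * Q + n * (Q - Q / P + 1) with hs
  have hs1 : -1 < s := by
    have : (n * (1 / P - 1 / Q) - 1 / Q) * Q < β * Q := by gcongr
    have h2 : (n * (1 / P - 1 / Q) - 1 / Q) * Q = n * (Q / P) - n - 1 := by
      field_simp
    have : s = β * Q - n * (Q / P) + n := by rw [hs]; ring
    linarith
  set B := ∫⁻ t in Ioo 0 r, ENNReal.ofReal t ^ s with hB
  have hBt : B ≠ ∞ := lintegral_Ioo_rpow_ne_top hr hs1
  have hQP : 0 ≤ Q - Q / P + 1 := by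
    have : Q / P ≤ Q := div_le_self hQ0.le hP
    linarith
  refine ⟨A ^ (Q - 1) * (ω ^ (Q - Q / P + 1) * M ^ (Q / P) * B), ?_, fun G hG hGM => ?_⟩
  · have h1 : A ^ (Q - 1) ≠ ∞ := ENNReal.rpow_ne_top_of_nonneg (by linarith) hAt
    have h2 : ω ^ (Q - Q / P + 1) ≠ ∞ := ENNReal.rpow_ne_top_of_nonneg hQP hω
    have h3 : M ^ (Q / P) ≠ ∞ := ENNReal.rpow_ne_top_of_nonneg (by positivity) hM
    finiteness
  have hmeas : Measurable fun z : Eucl n × ℝ =>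
      ENNReal.ofReal z.2 ^ (β - n) * ∫⁻ y in ball z.1 z.2, G y :=
    measurable_rpow_mul_lintegral_ball hG _
  have hpt : ∀ x, radialPotential r G x ^ Q ≤ A ^ (Q - 1) *
      ∫⁻ t in Ioo 0 r, (ENNReal.ofReal t ^ (β - n) * ∫⁻ y in ball x t, G y) ^ Q := by
    intro x
    refine le_trans (le_of_eq ?_) (rpow_lintegral_mul_le (volume.restrict (Ioo 0 r)) hQ1
      (w := fun t => ENNReal.ofReal t ^ (-β))
      (G := fun t => ENNReal.ofReal t ^ (β - n) * ∫⁻ y in ball x t, G y)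
      (ENNReal.measurable_ofReal.pow_const _) (hmeas.comp measurable_prodMk_left))
    congr 1
    refine setLIntegral_congr_fun measurableSet_Ioo fun t ht => ?_
    have h0 : ENNReal.ofReal t ≠ 0 := by simpa using ht.1
    rw [← mul_assoc, ← ENNReal.rpow_add _ _ h0 ENNReal.ofReal_ne_top]
    congr 2
    ring
  have hmeasQ := hmeas.pow_const Q
  calc ∫⁻ x, radialPotential r G x ^ Q
      ≤ ∫⁻ x, A ^ (Q - 1) *
        ∫⁻ t in Ioo 0 r, (ENNReal.ofReal t ^ (β - n) * ∫⁻ y in ball x t, G y) ^ Q :=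
        lintegral_mono hpt
    _ = A ^ (Q - 1) * ∫⁻ t in Ioo 0 r, ∫⁻ x,
          (ENNReal.ofReal t ^ (β - n) * ∫⁻ y in ball x t, G y) ^ Q := by
        rw [lintegral_const_mul _ hmeasQ.lintegral_prod_right',
          lintegral_lintegral_swap hmeasQ.aemeasurable]
    _ ≤ A ^ (Q - 1) * ∫⁻ t in Ioo 0 r,
          ω ^ (Q - Q / P + 1) * M ^ (Q / P) * ENNReal.ofReal t ^ s := by
        refine mul_le_mul_right ?_ _
        refine setLIntegral_mono' measurableSet_Ioo fun t ht => ?_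
        have h0 : ENNReal.ofReal t ≠ 0 := by simpa using ht.1
        simp_rw [ENNReal.mul_rpow_of_nonneg _ _ hQ0.le]
        rw [lintegral_const_mul _
          ((measurable_lintegral_ball_center hG t).pow_const Q)]
        calc _ ≤ (ENNReal.ofReal t ^ (β - n)) ^ Q *
              ((ENNReal.ofReal t ^ (n : ℝ) * ω) ^ (Q - Q / P + 1) * M ^ (Q / P)) := by
              gcongr
              exact lintegral_rpow_lintegral_ball_le hn hP hPQ.le hG hGM ht.1
          _ = ω ^ (Q - Q / P + 1) * M ^ (Q / P) * ((ENNReal.ofReal t ^ (β - n)) ^ Q *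
              (ENNReal.ofReal t ^ (n : ℝ)) ^ (Q - Q / P + 1)) := by
              rw [ENNReal.mul_rpow_of_nonneg _ _ hQP]; ring
          _ = _ := by
              rw [← ENNReal.rpow_mul, ← ENNReal.rpow_mul,
                ← ENNReal.rpow_add _ _ h0 ENNReal.ofReal_ne_top]
    _ = _ := by
        rw [lintegral_const_mul _ (ENNReal.measurable_ofReal.pow_const _)]

theorem lintegral_unitBall_comp_add_smul {n : ℕ} {H : Eucl n → ℝ≥0∞} (hH : Measurable H)
    (x : Eucl n) {t : ℝ} (ht : 0 < t) :
    ∫⁻ z in ball (0 : Eucl n) 1, H (x + t • z)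
      = ENNReal.ofReal t ^ (-(n : ℝ)) * ∫⁻ y in ball x t, H y := by
  have hmap : Measure.map (fun z : Eucl n => x + t • z) volume
      = ENNReal.ofReal t ^ (-(n : ℝ)) • volume := by
    have : (fun z : Eucl n => x + t • z) = (fun z => x + z) ∘ fun z => t • z := rfl
    rw [this, ← Measure.map_map (by fun_prop) (by fun_prop), Measure.map_addHaar_smul _ ht.ne',
      Measure.map_smul, map_add_left_eq_self, finrank_euclideanSpace_fin,
      abs_of_nonneg (by positivity), ENNReal.ofReal_inv_of_pos (by positivity),
      ENNReal.rpow_neg, ENNReal.rpow_natCast, ENNReal.ofReal_pow ht.le]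
  have hpre : (fun z : Eucl n => x + t • z) ⁻¹' ball x t = ball 0 1 := by
    ext z
    simp [norm_smul, abs_of_pos ht, ht]
  have h := setLIntegral_map (μ := volume) (measurableSet_ball (x := x) (ε := t)) hH
    (show Measurable fun z : Eucl n => x + t • z by fun_prop)
  rw [hmap, hpre, Measure.restrict_smul, lintegral_smul_measure, smul_eq_mul] at h
  exact h.symm

section UnitBallIntegral

variable {n : ℕ} {K : ℝ≥0} {f : Eucl n → ℝ}

theorem LipschitzWith.comp_add_smul_unitBall (hf : LipschitzWith K f) (x : Eucl n) {z : Eucl n}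
    (hz : z ∈ ball (0 : Eucl n) 1) : LipschitzWith K fun t : ℝ => f (x + t • z) := by
  refine LipschitzWith.of_dist_le_mul fun s t => (hf.dist_le_mul _ _).trans ?_
  have hz1 : ‖z‖ ≤ 1 := (mem_ball_zero_iff.1 hz).le
  rw [dist_add_left, dist_eq_norm, ← sub_smul, norm_smul, ← dist_eq_norm]
  gcongr
  exact mul_le_of_le_one_right dist_nonneg hz1

theorem LipschitzWith.integrableOn_unitBall (hf : LipschitzWith K f) (x : Eucl n) (t : ℝ) :
    IntegrableOn (fun z => f (x + t • z)) (ball (0 : Eucl n) 1) := by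
  have hc : Continuous fun z => f (x + t • z) := hf.continuous.comp (by fun_prop)
  exact (hc.continuousOn.integrableOn_compact (isCompact_closedBall 0 1)).mono_set
    ball_subset_closedBall

theorem LipschitzWith.integral_unitBall (hf : LipschitzWith K f) (x : Eucl n) :
    LipschitzWith (K * (volume (ball (0 : Eucl n) 1)).toNNReal)
      fun t : ℝ => ∫ z in ball (0 : Eucl n) 1, f (x + t • z) := by
  refine LipschitzWith.of_dist_le_mul fun s t => ?_
  rw [dist_eq_norm, ← integral_sub (hf.integrableOn_unitBall x s) (hf.integrableOn_unitBall x t)]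
  refine (norm_setIntegral_le_of_norm_le_const (C := K * dist s t) measure_ball_lt_top
    fun z hz => ?_).trans_eq ?_
  · rw [← dist_eq_norm]
    exact (hf.comp_add_smul_unitBall x hz).dist_le_mul s t
  · rw [NNReal.coe_mul, Measure.real, ENNReal.coe_toNNReal_eq_toReal]
    ring

theorem LipschitzWith.hasDerivAt_integral_unitBall (hf : LipschitzWith K f) (x : Eucl n) {t : ℝ}
    (ht : 0 < t) :
    HasDerivAt (fun t : ℝ => ∫ z in ball (0 : Eucl n) 1, f (x + t • z))
      (∫ z in ball (0 : Eucl n) 1, fderiv ℝ f (x + t • z) z) t := by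
  have hqmp : Measure.QuasiMeasurePreserving (fun z : Eucl n => x + t • z) volume volume := by
    refine (measurePreserving_add_left volume x).quasiMeasurePreserving.comp ⟨by fun_prop, ?_⟩
    rw [Measure.map_addHaar_smul _ ht.ne']
    exact Measure.smul_absolutelyContinuous
  have hdiff : ∀ᵐ z : Eucl n, DifferentiableAt ℝ f (x + t • z) := hqmp.ae hf.ae_differentiableAt
  refine (hasDerivAt_integral_of_dominated_loc_of_lip (bound := fun _ => (K : ℝ))
    (F := fun (t : ℝ) z => f (x + t • z))
    (F' := fun z => fderiv ℝ f (x + t • z) z) univ_mem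
    (Eventually.of_forall fun s => (hf.integrableOn_unitBall x s).aestronglyMeasurable)
    (hf.integrableOn_unitBall x t) ?_ ?_ ?_ ?_).2
  · have h1 : Measurable fun z : Eucl n => fderiv ℝ f (x + t • z) :=
      (measurable_fderiv ℝ f).comp (by fun_prop)
    exact (isBoundedBilinearMap_apply.continuous.comp_stronglyMeasurable
      (h1.stronglyMeasurable.prodMk stronglyMeasurable_id)).aestronglyMeasurable
  · filter_upwards [ae_restrict_mem measurableSet_ball] with z hz
    simpa using hf.comp_add_smul_unitBall x hz
  · exact integrableOn_const measure_ball_lt_top.ne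
  · filter_upwards [ae_restrict_of_ae hdiff] with z hz
    have h2 : HasDerivAt (fun s : ℝ => x + s • z) z t := by
      simpa using ((hasDerivAt_id t).smul_const z).const_add x
    exact hz.hasFDerivAt.comp_hasDerivAt t h2

/-- Pointwise control of a Lipschitz function by its mean and a potential of its gradient. -/
theorem LipschitzWith.volume_unitBall_mul_enorm_le (hf : LipschitzWith K f) {r : ℝ} (hr : 0 < r)
    (x : Eucl n) :
    volume (ball (0 : Eucl n) 1) * ‖f x‖ₑ
      ≤ ENNReal.ofReal r ^ (-(n : ℝ)) * (∫⁻ y, ‖f y‖ₑ)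
        + radialPotential r (fun y => ‖fderiv ℝ f y‖ₑ) x := by
  set A : ℝ → ℝ := fun t => ∫ z in ball (0 : Eucl n) 1, f (x + t • z) with hA
  have hLip : LipschitzWith _ A := hf.integral_unitBall x
  have hderiv : ∀ t, 0 < t → HasDerivAt A (deriv A t) t := fun t ht =>
    (hf.hasDerivAt_integral_unitBall x ht).differentiableAt.hasDerivAt
  have hint : IntervalIntegrable (deriv A) volume 0 r := by
    rw [intervalIntegrable_iff_integrableOn_Ioc_of_le hr.le]
    exact Measure.integrableOn_of_bounded measure_Ioc_lt_top.ne
      (measurable_deriv A).aestronglyMeasurable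
      (Eventually.of_forall fun t => norm_deriv_le_of_lipschitz hLip)
  have hftc := intervalIntegral.integral_eq_sub_of_hasDerivAt_of_le hr.le
    hLip.continuous.continuousOn (fun t ht => hderiv t ht.1) hint
  have hA0 : ‖A 0‖ₑ = volume (ball (0 : Eucl n) 1) * ‖f x‖ₑ := by
    have : A 0 = (volume (ball (0 : Eucl n) 1)).toReal * f x := by
      simp [hA, Measure.real]
    rw [this, enorm_mul]
    congr 1
    rw [Real.enorm_of_nonneg ENNReal.toReal_nonneg, ENNReal.ofReal_toReal measure_ball_lt_top.ne]
  have hAr : ‖A r‖ₑ ≤ ENNReal.ofReal r ^ (-(n : ℝ)) * ∫⁻ y, ‖f y‖ₑ := by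
    refine (enorm_integral_le_lintegral_enorm _).trans ?_
    rw [lintegral_unitBall_comp_add_smul (H := fun y => ‖f y‖ₑ) hf.continuous.measurable.enorm x hr]
    gcongr
    exact Measure.restrict_le_self
  have hpot : ‖∫ t in (0 : ℝ)..r, deriv A t‖ₑ
      ≤ radialPotential r (fun y => ‖fderiv ℝ f y‖ₑ) x := by
    rw [intervalIntegral.integral_of_le hr.le, integral_Ioc_eq_integral_Ioo]
    refine (enorm_integral_le_lintegral_enorm _).trans ?_
    refine setLIntegral_mono' measurableSet_Ioo fun t ht => ?_
    rw [(hf.hasDerivAt_integral_unitBall x ht.1).deriv, ← lintegral_unitBall_comp_add_smul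
      (H := fun y => ‖fderiv ℝ f y‖ₑ) (measurable_fderiv ℝ f).enorm x ht.1]
    refine (enorm_integral_le_lintegral_enorm _).trans ?_
    refine setLIntegral_mono' measurableSet_ball fun z hz => ?_
    refine (ContinuousLinearMap.le_opENorm _ _).trans ?_
    refine mul_le_of_le_one_right' ?_
    rw [← ofReal_norm, ENNReal.ofReal_le_one]
    exact (mem_ball_zero_iff.1 hz).le
  rw [hftc] at hpot
  calc _ = ‖A r - (A r - A 0)‖ₑ := by rw [sub_sub_cancel, hA0]
    _ ≤ ‖A r‖ₑ + ‖A r - A 0‖ₑ := enorm_sub_le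
    _ ≤ _ := add_le_add hAr hpot

end UnitBallIntegral

theorem setLIntegral_eq_of_tsupport_subset {n : ℕ} {f : Eucl n → ℝ} {Ω : Set (Eucl n)}
    (hf : tsupport f ⊆ Ω) : ∫⁻ y in Ω, ‖f y‖ₑ = ∫⁻ y, ‖f y‖ₑ := by
  refine setLIntegral_eq_of_support_subset fun y hy => hf (subset_tsupport f ?_)
  simpa using hy

theorem exists_lintegral_enorm_le_lintegral_fderiv {n : ℕ} (hn : n ≠ 0) {Ω : Set (Eucl n)}
    (hΩ : volume Ω ≠ ∞) :
    ∃ C : ℝ≥0∞, C ≠ ∞ ∧ ∀ f : Eucl n → ℝ, (∃ K : ℝ≥0, LipschitzWith K f) →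
      HasCompactSupport f → tsupport f ⊆ Ω → ∫⁻ y, ‖f y‖ₑ ≤ C * ∫⁻ y, ‖fderiv ℝ f y‖ₑ := by
  set ω := volume (ball (0 : Eucl n) 1) with hω
  have hωt : ω ≠ ∞ := measure_ball_lt_top.ne
  have hω0 : ω ≠ 0 := (measure_ball_pos _ _ one_pos).ne'
  obtain ⟨R, hR, hRΩ⟩ : ∃ R : ℝ, 0 < R ∧ ENNReal.ofReal R ^ (-(n : ℝ)) * volume Ω ≤ ω / 2 := by
    set a := (volume Ω).toReal with ha
    have ha0 : 0 ≤ a := ENNReal.toReal_nonneg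
    set w := ω.toReal with hw
    have hw0 : 0 < w := ENNReal.toReal_pos hω0 hωt
    refine ⟨1 + 2 * a / w, by positivity, ?_⟩
    have hR1 : 1 ≤ 1 + 2 * a / w := le_add_of_nonneg_right (by positivity)
    rw [ENNReal.ofReal_rpow_of_pos (by positivity), ← ENNReal.ofReal_toReal hΩ,
      ← ENNReal.ofReal_toReal hωt, ← ENNReal.ofReal_mul (by positivity), ← ha, ← hw,
      ← ENNReal.ofReal_ofNat 2, ← ENNReal.ofReal_div_of_pos two_pos]
    refine ENNReal.ofReal_le_ofReal ?_
    have hle : (1 + 2 * a / w) ^ (-(n : ℝ)) ≤ (1 + 2 * a / w) ^ (-1 : ℝ) := by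
      refine Real.rpow_le_rpow_of_exponent_le hR1 (neg_le_neg ?_)
      exact_mod_cast Nat.one_le_iff_ne_zero.2 hn
    refine (mul_le_mul_of_nonneg_right hle ha0).trans ?_
    rw [Real.rpow_neg_one, inv_mul_le_iff₀ (by positivity)]
    field_simp
    linarith
  refine ⟨2 * ENNReal.ofReal R, by finiteness, fun f ⟨K, hK⟩ hc hsub => ?_⟩
  set N := ∫⁻ y, ‖f y‖ₑ with hN
  set g : Eucl n → ℝ≥0∞ := fun y => ‖fderiv ℝ f y‖ₑ with hg
  have hgm : Measurable g := (measurable_fderiv ℝ f).enorm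
  have hNt : N ≠ ∞ := (hK.continuous.integrable_of_hasCompactSupport hc).2.ne
  have key : ω * N ≤ ω / 2 * N + ENNReal.ofReal R * (ω * ∫⁻ y, g y) := by
    calc ω * N = ∫⁻ x in Ω, ω * ‖f x‖ₑ := by
          rw [lintegral_const_mul _ hK.continuous.measurable.enorm,
            setLIntegral_eq_of_tsupport_subset hsub]
      _ ≤ ∫⁻ x in Ω, (ENNReal.ofReal R ^ (-(n : ℝ)) * N + radialPotential R g x) :=
          lintegral_mono fun x => hK.volume_unitBall_mul_enorm_le hR x
      _ = ENNReal.ofReal R ^ (-(n : ℝ)) * volume Ω * N + ∫⁻ x in Ω, radialPotential R g x := by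
          rw [lintegral_add_left measurable_const, setLIntegral_const]
          ring
      _ ≤ ω / 2 * N + ∫⁻ x, radialPotential R g x := by
          gcongr
          exact Measure.restrict_le_self
      _ = _ := by rw [lintegral_radialPotential hn hgm]
  have h2 : ω / 2 * N + ω / 2 * N ≤ ω / 2 * N + ENNReal.ofReal R * (ω * ∫⁻ y, g y) := by
    rwa [← add_mul, ENNReal.add_halves]
  have h3 := (ENNReal.add_le_add_iff_left (by finiteness)).1 h2
  have h4 : ω * N ≤ ω * (2 * ENNReal.ofReal R * ∫⁻ y, g y) := by
    calc ω * N = 2 * (ω / 2 * N) := by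
          rw [← mul_assoc, ENNReal.mul_div_cancel (by simp) (by simp)]
      _ ≤ 2 * (ENNReal.ofReal R * (ω * ∫⁻ y, g y)) := by gcongr
      _ = _ := by ring
  exact (ENNReal.mul_le_mul_iff_right hω0 hωt).1 h4

theorem rpow_enorm_le_one_add {a P s : ℝ} (hP : 0 ≤ P) (hPs : P ≤ s) :
    ‖a‖ₑ ^ P ≤ 1 + ENNReal.ofReal (|a| ^ s) := by
  rw [Real.enorm_eq_ofReal_abs, ENNReal.ofReal_rpow_of_nonneg (abs_nonneg a) hP, ← ENNReal.ofReal_one,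
    ← ENNReal.ofReal_add zero_le_one (by positivity)]
  refine ENNReal.ofReal_le_ofReal ?_
  rcases le_total |a| 1 with h | h
  · have := Real.rpow_le_one (abs_nonneg a) h hP
    have : 0 ≤ |a| ^ s := by positivity
    linarith
  · have := Real.rpow_le_rpow_of_exponent_le h hPs
    linarith

theorem ofReal_rpow_le_one_add {a s Q : ℝ} (hs : 0 ≤ s) (hsQ : s ≤ Q) :
    ENNReal.ofReal (|a| ^ s) ≤ 1 + ‖a‖ₑ ^ Q := by
  rw [Real.enorm_eq_ofReal_abs, ENNReal.ofReal_rpow_of_nonneg (abs_nonneg a) (hs.trans hsQ),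
    ← ENNReal.ofReal_one, ← ENNReal.ofReal_add zero_le_one (by positivity)]
  refine ENNReal.ofReal_le_ofReal ?_
  rcases le_total |a| 1 with h | h
  · have := Real.rpow_le_one (abs_nonneg a) h hs
    have : 0 ≤ |a| ^ Q := by positivity
    linarith
  · have := Real.rpow_le_rpow_of_exponent_le h hsQ
    linarith

theorem enorm_fderiv_eq_zero {n : ℕ} {f : Eucl n → ℝ} {Ω : Set (Eucl n)} (hf : tsupport f ⊆ Ω)
    {y : Eucl n} (hy : y ∉ Ω) : ‖fderiv ℝ f y‖ₑ = 0 := by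
  rw [← ofReal_norm, fderiv_of_notMem_tsupport ℝ fun h => hy (hf h), norm_zero, ENNReal.ofReal_zero]

/-- On a set where `P ≤ p`, a modular bound for the gradient in `L^{p(·)}` bounds it in `L^P`. -/
theorem setLIntegral_enorm_fderiv_rpow_le {n : ℕ} {Ω U : Set (Eucl n)} (hΩ : MeasurableSet Ω)
    (hU : MeasurableSet U) {p : Eucl n → ℝ} {P : ℝ} (hP : 0 < P) (hPp : ∀ y ∈ U ∩ Ω, P ≤ p y)
    {f : Eucl n → ℝ} (hsub : tsupport f ⊆ Ω)
    (hmod : ∫⁻ y in Ω, ENNReal.ofReal (|gradNorm f y| ^ p y) ≤ 1) :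
    ∫⁻ y in U, ‖fderiv ℝ f y‖ₑ ^ P ≤ volume Ω + 1 := by
  calc ∫⁻ y in U, ‖fderiv ℝ f y‖ₑ ^ P
      = ∫⁻ y in U ∩ Ω, ‖fderiv ℝ f y‖ₑ ^ P := by
        rw [← lintegral_indicator hU, ← lintegral_indicator (hU.inter hΩ)]
        refine lintegral_congr fun y => ?_
        by_cases hy : y ∈ Ω <;> by_cases hyU : y ∈ U <;>
          simp [hy, hyU, hP, enorm_fderiv_eq_zero hsub]
    _ ≤ ∫⁻ y in U ∩ Ω, (1 + ENNReal.ofReal (|gradNorm f y| ^ p y)) := by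
        refine setLIntegral_mono' (hU.inter hΩ) fun y hy => ?_
        have h := rpow_enorm_le_one_add (a := gradNorm f y) hP.le (hPp y hy)
        rwa [gradNorm, enorm_norm] at h
    _ ≤ ∫⁻ y in Ω, (1 + ENNReal.ofReal (|gradNorm f y| ^ p y)) :=
        lintegral_mono_set inter_subset_right
    _ = volume Ω + ∫⁻ y in Ω, ENNReal.ofReal (|gradNorm f y| ^ p y) := by
        rw [lintegral_add_left measurable_const, setLIntegral_one]
    _ ≤ _ := by gcongr

theorem radialPotential_indicator {n : ℕ} {r : ℝ} (G : Eucl n → ℝ≥0∞) {x y : Eucl n}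
    (hx : x ∈ ball y r) :
    radialPotential r ((ball y (2 * r)).indicator G) x = radialPotential r G x := by
  refine setLIntegral_congr_fun measurableSet_Ioo fun t ht => ?_
  congr 1
  refine setLIntegral_congr_fun measurableSet_ball fun z hz => indicator_of_mem ?_ G
  rw [mem_ball] at *
  have := dist_triangle z x y
  linarith [ht.2]

theorem exists_setLIntegral_ball_enorm_rpow_le {n : ℕ} (hn : n ≠ 0) {Ω : Set (Eucl n)}
    (hΩ : MeasurableSet Ω) (hΩt : volume Ω ≠ ∞) {p : Eucl n → ℝ} (hp : ∀ x ∈ Ω, 1 ≤ p x)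
    {y : Eucl n} {r : ℝ} (hr : 0 < r) {P Q : ℝ} (hP : 1 ≤ P) (hPQ : P < Q)
    (hκ : 1 / P - 1 / Q < 1 / n) (hPp : ∀ z ∈ ball y (2 * r) ∩ Ω, P ≤ p z) :
    ∃ C : ℝ≥0∞, C ≠ ∞ ∧ ∀ f : Eucl n → ℝ, (∃ K : ℝ≥0, LipschitzWith K f) →
      HasCompactSupport f → tsupport f ⊆ Ω →
      ∫⁻ z in Ω, ENNReal.ofReal (|gradNorm f z| ^ p z) ≤ 1 →
      ∫⁻ x in ball y r, ‖f x‖ₑ ^ Q ≤ C := by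
  set M := volume Ω + 1 with hM
  have hMt : M ≠ ∞ := by finiteness
  obtain ⟨C₁, hC₁, hf₁⟩ := exists_lintegral_enorm_le_lintegral_fderiv hn hΩt
  obtain ⟨C₂, hC₂, hf₂⟩ := exists_lintegral_radialPotential_rpow_le hn hP hPQ hκ hr hMt
  have hQ1 : 1 ≤ Q := by linarith
  have hQ0 : 0 ≤ Q := by linarith
  set ω := volume (ball (0 : Eucl n) 1) with hω
  have hωt : ω ≠ ∞ := measure_ball_lt_top.ne
  have hω0 : ω ≠ 0 := (measure_ball_pos _ _ one_pos).ne'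
  set a := ENNReal.ofReal r ^ (-(n : ℝ)) * (C₁ * M) with ha
  have hat : a ≠ ∞ := by
    have : ENNReal.ofReal r ^ (-(n : ℝ)) ≠ ∞ := by
      rw [ENNReal.ofReal_rpow_of_pos hr]; exact ENNReal.ofReal_ne_top
    finiteness
  refine ⟨ω⁻¹ ^ Q * (2 ^ (Q - 1) * (a ^ Q * volume (ball y r) + C₂)), ?_,
    fun f hlip hc hsub hmod => ?_⟩
  · have h1 : ω⁻¹ ^ Q ≠ ∞ := ENNReal.rpow_ne_top_of_nonneg hQ0 (ENNReal.inv_ne_top.2 hω0)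
    have h2 : (2 : ℝ≥0∞) ^ (Q - 1) ≠ ∞ := ENNReal.rpow_ne_top_of_nonneg (by linarith) (by simp)
    have h3 : a ^ Q ≠ ∞ := ENNReal.rpow_ne_top_of_nonneg hQ0 hat
    have h4 : volume (ball y r) ≠ ∞ := measure_ball_lt_top.ne
    finiteness
  set g : Eucl n → ℝ≥0∞ := fun z => ‖fderiv ℝ f z‖ₑ with hg
  have hgm : Measurable g := (measurable_fderiv ℝ f).enorm
  set G := (ball y (2 * r)).indicator g with hG
  have hGm : Measurable G := hgm.indicator measurableSet_ball
  have hGP : ∫⁻ z, G z ^ P ≤ M := by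
    refine le_trans (le_of_eq ?_) (setLIntegral_enorm_fderiv_rpow_le hΩ measurableSet_ball
      (by linarith) hPp hsub hmod)
    rw [← lintegral_indicator measurableSet_ball]
    refine lintegral_congr fun z => ?_
    by_cases hz : z ∈ ball y (2 * r)
    · rw [hG, indicator_of_mem hz, indicator_of_mem hz]
    · rw [hG, indicator_of_notMem hz, indicator_of_notMem hz,
        ENNReal.zero_rpow_of_pos (by linarith)]
  have hg1 : ∫⁻ z, g z ≤ M := by
    have h := setLIntegral_enorm_fderiv_rpow_le hΩ MeasurableSet.univ one_pos
      (fun z hz => hp z hz.2) hsub hmod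
    simpa using h
  have hfa : ENNReal.ofReal r ^ (-(n : ℝ)) * ∫⁻ z, ‖f z‖ₑ ≤ a := by
    have := hf₁ f hlip hc hsub
    rw [ha]
    gcongr
    exact this.trans (by gcongr)
  obtain ⟨K, hK⟩ := hlip
  have hpt : ∀ x ∈ ball y r, ‖f x‖ₑ ^ Q
      ≤ ω⁻¹ ^ Q * (2 ^ (Q - 1) * (a ^ Q + radialPotential r G x ^ Q)) := by
    intro x hx
    have h := hK.volume_unitBall_mul_enorm_le hr x
    rw [← radialPotential_indicator _ hx] at h
    calc ‖f x‖ₑ ^ Q = (ω⁻¹ * (ω * ‖f x‖ₑ)) ^ Q := by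
          rw [← mul_assoc, ENNReal.inv_mul_cancel hω0 hωt, one_mul]
      _ ≤ (ω⁻¹ * (a + radialPotential r G x)) ^ Q := by
          gcongr
          exact h.trans (add_le_add_left hfa _)
      _ = ω⁻¹ ^ Q * (a + radialPotential r G x) ^ Q := ENNReal.mul_rpow_of_nonneg _ _ hQ0
      _ ≤ _ := by
          gcongr
          exact ENNReal.rpow_add_le_mul_rpow_add_rpow _ _ hQ1
  have hpm : Measurable fun x => radialPotential r G x ^ Q :=
    (measurable_radialPotential r hGm).pow_const Q
  calc ∫⁻ x in ball y r, ‖f x‖ₑ ^ Q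
      ≤ ∫⁻ x in ball y r, ω⁻¹ ^ Q * (2 ^ (Q - 1) * (a ^ Q + radialPotential r G x ^ Q)) :=
        setLIntegral_mono' measurableSet_ball hpt
    _ = ω⁻¹ ^ Q * (2 ^ (Q - 1) *
          (a ^ Q * volume (ball y r) + ∫⁻ x in ball y r, radialPotential r G x ^ Q)) := by
        rw [lintegral_const_mul _ (by fun_prop), lintegral_const_mul _ (by fun_prop),
          lintegral_add_left measurable_const, setLIntegral_const]
    _ ≤ _ := by
        gcongr
        exact (setLIntegral_le_lintegral _ _).trans (hf₂ G hGm hGP)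

/-- If the oscillation of `1 / p` on a ball is small and `1 / q` is bounded below by a positive
constant, a modular bound for the gradient bounds the modular of the function on the half ball. -/
theorem exists_setLIntegral_ball_modular_le {n : ℕ} (hn : n ≠ 0) {Ω : Set (Eucl n)}
    (hΩ : MeasurableSet Ω) (hΩt : volume Ω ≠ ∞) {p q : Eucl n → ℝ} (hp : ∀ x ∈ Ω, 1 ≤ p x)
    {α c σ : ℝ} (hα : 0 ≤ α) (hc : 0 < c) (hσ0 : 0 < σ) (hσ : σ < 1 - α)
    (hq : ∀ x ∈ Ω, 1 / q x = 1 / p x - α / n)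
    (hqc : ∀ᵐ x ∂volume.restrict Ω, c ≤ 1 / q x) {y : Eucl n} {r : ℝ} (hr : 0 < r)
    (hosc : ∀ x ∈ ball y (2 * r) ∩ Ω, ∀ z ∈ ball y (2 * r) ∩ Ω, |1 / p z - 1 / p x| < σ / n) :
    ∃ C : ℝ≥0∞, C ≠ ∞ ∧ ∀ f : Eucl n → ℝ, (∃ K : ℝ≥0, LipschitzWith K f) →
      HasCompactSupport f → tsupport f ⊆ Ω →
      ∫⁻ z in Ω, ENNReal.ofReal (|gradNorm f z| ^ p z) ≤ 1 →
      ∫⁻ x in ball y r ∩ Ω, ENNReal.ofReal (|f x| ^ q x) ≤ C := by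
  have hn0 : (0 : ℝ) < n := by exact_mod_cast Nat.pos_of_ne_zero hn
  set U := ball y (2 * r) ∩ Ω with hU
  rcases U.eq_empty_or_nonempty with hUe | ⟨x₀, hx₀⟩
  · refine ⟨0, ENNReal.zero_ne_top, fun f _ _ _ _ => ?_⟩
    have : ball y r ∩ Ω = ∅ := subset_empty_iff.1 <|
      (inter_subset_inter_left _ (ball_subset_ball (by linarith))).trans hUe.subset
    simp [this]
  have hp1 : ∀ x ∈ U, 1 / p x ≤ 1 := fun x hx =>
    div_le_one_of_le₀ (hp x hx.2) (by linarith [hp x hx.2])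
  have hp0 : ∀ x ∈ U, 0 < 1 / p x := fun x hx => one_div_pos.2 (by linarith [hp x hx.2])
  set S := (fun x => 1 / p x) '' U with hS
  have hSne : S.Nonempty := ⟨_, mem_image_of_mem _ hx₀⟩
  have hSb : BddAbove S := ⟨1, by rintro _ ⟨x, hx, rfl⟩; exact hp1 x hx⟩
  set s := sSup S with hs
  have hle : ∀ x ∈ U, 1 / p x ≤ s := fun x hx => le_csSup hSb (mem_image_of_mem _ hx)
  have hs0 : 0 < s := (hp0 x₀ hx₀).trans_le (hle x₀ hx₀)
  have hs1 : s ≤ 1 := csSup_le hSne (by rintro _ ⟨x, hx, rfl⟩; exact hp1 x hx)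
  have hsosc : ∀ x ∈ U, s - σ / n ≤ 1 / p x := by
    intro x hx
    have : s ≤ 1 / p x + σ / n := by
      refine csSup_le hSne ?_
      rintro _ ⟨z, hz, rfl⟩
      have := (abs_lt.1 (hosc x hx z hz)).2
      simp only
      linarith
    linarith
  set u := max (s - (σ + α) / n) (min c (s / 2)) with hu
  have hu0 : 0 < u := lt_max_of_lt_right (lt_min hc (by linarith))
  have hus : u < s := by
    refine max_lt ?_ ((min_le_right _ _).trans_lt (by linarith))
    have : 0 < (σ + α) / n := by positivity
    linarith
  have hκ : s - u < 1 / n := by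
    have h1 : s - (σ + α) / n ≤ u := le_max_left _ _
    have h2 : (σ + α) / n < 1 / n := by gcongr; linarith
    linarith
  have hPp : ∀ x ∈ U, 1 / s ≤ p x := fun x hx => by
    have hpx : 0 < p x := by linarith [hp x hx.2]
    rw [div_le_iff₀ hs0]
    have := hle x hx
    rw [div_le_iff₀ hpx] at this
    linarith
  obtain ⟨C, hC, hCf⟩ := exists_setLIntegral_ball_enorm_rpow_le hn hΩ hΩt hp hr
    (P := 1 / s) (Q := 1 / u) (by rw [le_div_iff₀ hs0]; linarith)
    (one_div_lt_one_div_of_lt hu0 hus) (by simpa using hκ) hPp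
  refine ⟨volume Ω + C, by finiteness, fun f hlip hcs hsub hmod => ?_⟩
  have hae : ∀ᵐ x ∂volume.restrict (ball y r ∩ Ω),
      ENNReal.ofReal (|f x| ^ q x) ≤ 1 + ‖f x‖ₑ ^ (1 / u) := by
    filter_upwards [ae_restrict_of_ae_restrict_of_subset inter_subset_right hqc,
      ae_restrict_mem (measurableSet_ball.inter hΩ)] with x hx hxm
    have hxU : x ∈ U := ⟨ball_subset_ball (by linarith) hxm.1, hxm.2⟩
    have hq0 : 0 < q x := one_div_pos.1 (hc.trans_le hx)
    refine ofReal_rpow_le_one_add hq0.le ?_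
    rw [le_div_iff₀ hu0]
    have huq : u ≤ 1 / q x := by
      refine max_le ?_ ((min_le_left _ _).trans hx)
      rw [hq x hxm.2]
      have := hsosc x hxU
      have h2 : (σ + α) / n = σ / n + α / n := add_div _ _ _
      linarith
    rw [le_div_iff₀ hq0] at huq
    linarith
  calc ∫⁻ x in ball y r ∩ Ω, ENNReal.ofReal (|f x| ^ q x)
      ≤ ∫⁻ x in ball y r ∩ Ω, (1 + ‖f x‖ₑ ^ (1 / u)) := lintegral_mono_ae hae
    _ = volume (ball y r ∩ Ω) + ∫⁻ x in ball y r ∩ Ω, ‖f x‖ₑ ^ (1 / u) := by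
        rw [lintegral_add_left measurable_const, setLIntegral_one]
    _ ≤ volume Ω + ∫⁻ x in ball y r, ‖f x‖ₑ ^ (1 / u) :=
        add_le_add (measure_mono inter_subset_right) (lintegral_mono_set inter_subset_left)
    _ ≤ _ := by gcongr; exact hCf f hlip hcs hsub hmod

theorem exists_setLIntegral_modular_le {n : ℕ} (hn : n ≠ 0) {Ω : Set (Eucl n)}
    (hΩ : MeasurableSet Ω) (hΩb : Bornology.IsBounded Ω) {p q : Eucl n → ℝ}
    (hp : ∀ x ∈ Ω, 1 ≤ p x) {α c σ : ℝ} (hα : 0 ≤ α) (hc : 0 < c) (hσ0 : 0 < σ) (hσ : σ < 1 - α)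
    (hq : ∀ x ∈ Ω, 1 / q x = 1 / p x - α / n)
    (hqc : ∀ᵐ x ∂volume.restrict Ω, c ≤ 1 / q x)
    (hcont : UnifEpsCont Ω (fun x => 1 / p x) (σ / n)) :
    ∃ C : ℝ≥0∞, C ≠ ∞ ∧ ∀ f : Eucl n → ℝ, (∃ K : ℝ≥0, LipschitzWith K f) →
      HasCompactSupport f → tsupport f ⊆ Ω →
      ∫⁻ z in Ω, ENNReal.ofReal (|gradNorm f z| ^ p z) ≤ 1 →
      ∫⁻ x in Ω, ENNReal.ofReal (|f x| ^ q x) ≤ C := by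
  obtain ⟨δ, hδ, hosc⟩ := hcont
  have hr : 0 < δ / 4 := by linarith
  obtain ⟨T, hT, hcov⟩ := Metric.totallyBounded_iff.1
    (hΩb.isCompact_closure.totallyBounded.subset subset_closure) (δ / 4) hr
  have hloc := fun y : Eucl n => exists_setLIntegral_ball_modular_le hn hΩ hΩb.measure_lt_top.ne hp
    hα hc hσ0 hσ hq hqc (y := y) hr fun x hx z hz => hosc x hx.2 z hz.2 (by
      have h1 := mem_ball.1 hx.1
      have h2 := mem_ball.1 hz.1
      have := dist_triangle_right x z y
      linarith)
  choose C hC hCf using hloc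
  have : Fintype T := hT.fintype
  refine ⟨∑ y : T, C y, ENNReal.sum_ne_top.2 fun y _ => hC y, fun f hlip hcs hsub hmod => ?_⟩
  calc ∫⁻ x in Ω, ENNReal.ofReal (|f x| ^ q x)
      ≤ ∫⁻ x in ⋃ y : T, ball (y : Eucl n) (δ / 4) ∩ Ω, ENNReal.ofReal (|f x| ^ q x) := by
        refine lintegral_mono_set fun x hx => ?_
        obtain ⟨y, hy, hxy⟩ := mem_iUnion₂.1 (hcov hx)
        exact mem_iUnion.2 ⟨⟨y, hy⟩, hxy, hx⟩
    _ ≤ ∑' y : T, ∫⁻ x in ball (y : Eucl n) (δ / 4) ∩ Ω, ENNReal.ofReal (|f x| ^ q x) :=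
        lintegral_iUnion_le _ _
    _ = ∑ y : T, ∫⁻ x in ball (y : Eucl n) (δ / 4) ∩ Ω, ENNReal.ofReal (|f x| ^ q x) :=
        tsum_fintype _
    _ ≤ _ := Finset.sum_le_sum fun y _ => hCf y f hlip hcs hsub hmod

theorem gradNorm_const_mul {n : ℕ} {c : ℝ} (f : Eucl n → ℝ) (x : Eucl n) :
    gradNorm (fun y => c * f y) x = |c| * gradNorm f x := by
  have : (fun y => c * f y) = c • f := rfl
  rw [gradNorm, gradNorm, this, fderiv_const_smul_field, Pi.smul_apply, norm_smul, Real.norm_eq_abs]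

theorem LipschitzWith.memVarLp_gradNorm {n : ℕ} {Ω : Set (Eucl n)} (hΩ : MeasurableSet Ω)
    (hΩt : volume Ω ≠ ∞) {p : Eucl n → ℝ} (hp : ∀ x ∈ Ω, 1 ≤ p x) {K : ℝ≥0} {f : Eucl n → ℝ}
    (hf : LipschitzWith K f) : MemVarLp Ω p (gradNorm f) := by
  set v := (volume Ω).toReal with hv
  have hv0 : 0 ≤ v := ENNReal.toReal_nonneg
  set l : ℝ := (K + 1) * (v + 1) with hl
  have hl0 : 0 < l := by positivity
  refine ⟨l, hl0, ?_⟩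
  calc ∫⁻ x in Ω, ENNReal.ofReal ((|gradNorm f x| / l) ^ p x)
      ≤ ∫⁻ x in Ω, ENNReal.ofReal (1 / (v + 1)) := by
        refine setLIntegral_mono' hΩ fun x hx => ENNReal.ofReal_le_ofReal ?_
        have hK : |gradNorm f x| ≤ K := by
          rw [gradNorm, abs_norm]
          exact norm_fderiv_le_of_lipschitz ℝ hf
        have h1 : |gradNorm f x| / l ≤ 1 / (v + 1) := by
          rw [hl, ← div_div]
          gcongr
          rw [div_le_one (by positivity)]
          linarith
        have h2 : 1 / (v + 1) ≤ 1 := by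
          rw [div_le_one (by positivity)]
          linarith
        have h3 := Real.rpow_le_rpow_of_exponent_ge' (by positivity) (h1.trans h2) zero_le_one
          (hp x hx)
        rw [Real.rpow_one] at h3
        exact h3.trans h1
    _ = ENNReal.ofReal (1 / (v + 1) * v) := by
        rw [setLIntegral_const, ENNReal.ofReal_mul (by positivity), hv,
          ENNReal.ofReal_toReal hΩt]
    _ ≤ 1 := by
        rw [ENNReal.ofReal_le_one, one_div_mul_eq_div, div_le_one (by positivity)]
        linarith

/-- Dividing by a constant at least `1` that dominates the modular makes the modular at most `1`,
for exponents at least `1`. -/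
theorem setLIntegral_div_rpow_le_one {n : ℕ} {Ω : Set (Eucl n)} {q f : Eucl n → ℝ}
    (hq : ∀ᵐ x ∂volume.restrict Ω, 1 ≤ q x) {C : ℝ} (hC : 1 ≤ C)
    (hmod : ∫⁻ x in Ω, ENNReal.ofReal (|f x| ^ q x) ≤ ENNReal.ofReal C) :
    ∫⁻ x in Ω, ENNReal.ofReal ((|f x| / C) ^ q x) ≤ 1 := by
  have hC0 : 0 < C := by linarith
  calc ∫⁻ x in Ω, ENNReal.ofReal ((|f x| / C) ^ q x)
      ≤ ∫⁻ x in Ω, ENNReal.ofReal C⁻¹ * ENNReal.ofReal (|f x| ^ q x) := by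
        refine lintegral_mono_ae ?_
        filter_upwards [hq] with x hx
        rw [← ENNReal.ofReal_mul (by positivity)]
        refine ENNReal.ofReal_le_ofReal ?_
        rw [div_eq_inv_mul, Real.mul_rpow (by positivity) (abs_nonneg _)]
        gcongr
        have h := Real.rpow_le_rpow_of_exponent_ge' (x := C⁻¹) (by positivity)
          (inv_le_one_of_one_le₀ hC) zero_le_one hx
        rwa [Real.rpow_one] at h
    _ = ENNReal.ofReal C⁻¹ * ∫⁻ x in Ω, ENNReal.ofReal (|f x| ^ q x) :=
        lintegral_const_mul' _ _ ENNReal.ofReal_ne_top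
    _ ≤ ENNReal.ofReal C⁻¹ * ENNReal.ofReal C := by gcongr
    _ = 1 := by
        rw [← ENNReal.ofReal_mul (by positivity), inv_mul_cancel₀ hC0.ne', ENNReal.ofReal_one]

theorem luxNorm_le_mul_luxNorm {n : ℕ} {Ω : Set (Eucl n)} {p q f g : Eucl n → ℝ} {C : ℝ}
    (hC : 0 < C) (hg : MemVarLp Ω p g)
    (h : ∀ l : ℝ, 0 < l → ∫⁻ x in Ω, ENNReal.ofReal ((|g x| / l) ^ p x) ≤ 1 →
      ∫⁻ x in Ω, ENNReal.ofReal ((|f x| / (C * l)) ^ q x) ≤ 1) :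
    luxNorm Ω q f ≤ C * luxNorm Ω p g := by
  rw [← div_le_iff₀' hC]
  refine le_csInf hg ?_
  rintro l ⟨hl, hmod⟩
  rw [div_le_iff₀' hC]
  exact csInf_le ⟨0, fun _ h => h.1.le⟩ ⟨mul_pos hC hl, h l hl hmod⟩

/-- Theorem 1.5, Sobolev inequality on bounded domains. -/
theorem sobolev_inequality_rough_exponent
    (n : ℕ) (hn : 2 ≤ n) (Ω : Set (Eucl n))
    (hΩo : IsOpen Ω) (hΩc : IsConnected Ω) (hΩb : Bornology.IsBounded Ω)
    (p : Eucl n → ℝ) (hpm : Measurable p) (hp1 : ∀ x ∈ Ω, 1 ≤ p x)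
    (hpb : ∃ M : ℝ, ∀ᵐ x ∂(volume.restrict Ω), p x ≤ M)
    (hpminus : 1 < essInfOn p Ω)
    (α : ℝ) (hα0 : 0 ≤ α)
    (hα1 : essSupOn p Ω < n → α < 1)
    (hα2 : (n : ℝ) ≤ essSupOn p Ω → α < n / essSupOn p Ω)
    (q : Eucl n → ℝ) (hq : ∀ x ∈ Ω, 1 / q x = 1 / p x - α / n)
    (hcont : ∃ σ : ℝ, σ < 1 - α ∧ UnifEpsCont Ω (fun x => 1 / p x) (σ / n)) :
    ∃ C : ℝ, ∀ f : Eucl n → ℝ, (∃ K : NNReal, LipschitzWith K f) →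
      HasCompactSupport f → tsupport f ⊆ Ω →
      luxNorm Ω q f ≤ C * luxNorm Ω p (gradNorm f) := by
  have hn0 : n ≠ 0 := by omega
  have hnpos : (0 : ℝ) < n := by exact_mod_cast Nat.pos_of_ne_zero hn0
  obtain ⟨x₀, hx₀⟩ := hΩc.nonempty
  obtain ⟨σ, hσ, hucont⟩ := hcont
  have hσ0 : 0 < σ := by
    obtain ⟨δ, hδ, h⟩ := hucont
    have h0 := h x₀ hx₀ x₀ hx₀ (by simpa using hδ)
    rw [sub_self, abs_zero] at h0
    exact (div_pos_iff_of_pos_right hnpos).1 h0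
  have hΩm := hΩo.measurableSet
  have hpM : ∀ᵐ x ∂volume.restrict Ω, p x ≤ essSupOn p Ω := by
    obtain ⟨M, hM⟩ := hpb
    exact ae_le_essSup ⟨M, by simpa using hM⟩
  have hM1 : 1 ≤ essSupOn p Ω := by
    have : NeBot (ae (volume.restrict Ω)) := by
      rw [ae_neBot, Ne, Measure.restrict_eq_zero]
      exact (hΩo.measure_pos volume ⟨x₀, hx₀⟩).ne'
    obtain ⟨x, hx, hxΩ⟩ := (hpM.and (ae_restrict_mem hΩm)).exists
    exact (hp1 x hxΩ).trans hx
  set M := essSupOn p Ω with hM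
  have hM0 : 0 < M := by linarith
  have hc : 0 < 1 / M - α / n := by
    rw [sub_pos, div_lt_div_iff₀ hnpos hM0]
    rcases lt_or_ge M n with h | h
    · nlinarith [hα1 h]
    · have := hα2 h
      rw [lt_div_iff₀ hM0] at this
      linarith
  have hqc : ∀ᵐ x ∂volume.restrict Ω, 1 / M - α / n ≤ 1 / q x := by
    filter_upwards [hpM, ae_restrict_mem hΩm] with x hx hxΩ
    rw [hq x hxΩ]
    have : 0 < p x := by linarith [hp1 x hxΩ]
    gcongr
  have hq1 : ∀ᵐ x ∂volume.restrict Ω, 1 ≤ q x := by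
    filter_upwards [hqc, ae_restrict_mem hΩm] with x hx hxΩ
    have hq0 : 0 < q x := one_div_pos.1 (hc.trans_le hx)
    have h1 : 1 / p x ≤ 1 := div_le_one_of_le₀ (hp1 x hxΩ) (by linarith [hp1 x hxΩ])
    have h2 : 0 ≤ α / n := by positivity
    rw [← one_div_le_one_div hq0 one_pos, hq x hxΩ]
    linarith
  obtain ⟨C, hC, hCf⟩ := exists_setLIntegral_modular_le hn0 hΩm hΩb hp1 hα0 hc hσ0 hσ hq hqc hucont
  have hC1 : 1 ≤ max 1 C.toReal := le_max_left _ _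
  refine ⟨max 1 C.toReal, fun f hlip hcs hsub => ?_⟩
  have hC0 : 0 < max 1 C.toReal := by linarith
  have hmem : MemVarLp Ω p (gradNorm f) := by
    obtain ⟨K, hK⟩ := hlip
    exact hK.memVarLp_gradNorm hΩm hΩb.measure_lt_top.ne hp1
  refine luxNorm_le_mul_luxNorm hC0 hmem fun l hl hmod => ?_
  set h : Eucl n → ℝ := fun y => l⁻¹ * f y with hh
  have habs : ∀ x, |h x| = |f x| / l := fun x => by
    rw [hh, abs_mul, abs_of_pos (inv_pos.2 hl), inv_mul_eq_div]
  have hgrad : ∀ x, |gradNorm h x| = |gradNorm f x| / l := fun x => by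
    rw [hh, gradNorm_const_mul, abs_mul, abs_abs, abs_of_pos (inv_pos.2 hl), inv_mul_eq_div]
  have hhlip : ∃ K : ℝ≥0, LipschitzWith K h := by
    obtain ⟨K, hK⟩ := hlip
    exact ⟨_, (lipschitzWith_smul l⁻¹).comp hK⟩
  have hhsub : tsupport h ⊆ Ω := (tsupport_mul_subset_right (f := fun _ => l⁻¹)).trans hsub
  have hhcs : HasCompactSupport h := hcs.mul_left
  have hhmod : ∫⁻ x in Ω, ENNReal.ofReal (|gradNorm h x| ^ p x) ≤ 1 := by
    simp_rw [hgrad]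
    exact hmod
  have hbound := hCf h hhlip hhcs hhsub hhmod
  have hfin := setLIntegral_div_rpow_le_one hq1 hC1 (hbound.trans (by
    rw [← ENNReal.ofReal_toReal hC]
    exact ENNReal.ofReal_le_ofReal (by simp)))
  simpa only [habs, div_div, mul_comm l] using hfin
end
end

section
/- Let Ω ⊂ ℝⁿ be a bounded domain with a tree-covering {U_t}_{t∈Γ} obtained from a Whitney decomposition (U_t = (17/16)·int(Q_t)). Let p(·) be an exponent function with 1 ≤ p_- ≤ p_+ < ∞ and p(·) ∈ ∂LH_0^τ(Ω) for some τ ≥ 1. Then the operator T_{p(·)} f(x) = Σ_{t∈Γ} χ_{U_t}(x) ‖f χ_{U_t}‖_{L^{p(·)}(Ω)}/‖χ_{U_t}‖_{L^{p(·)}(Ω)} is bounded from L^{p(·)}(Ω) to itself. -/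
open MeasureTheory Metric Set Filter Topology

noncomputable section

/-- The closed dyadic cube of generation `k` with lattice coordinates `z`. -/
def cubeQ {n : ℕ} (k : ℤ) (z : Fin n → ℤ) : Set (Eucl n) :=
  {x | ∀ i, |x i - ((z i : ℝ) + 1 / 2) * (2:ℝ) ^ (-k)| ≤ (2:ℝ) ^ (-k) / 2}

/-- The expanded open cube `U = (17/16)·int(Q)`. -/
def cubeU {n : ℕ} (k : ℤ) (z : Fin n → ℤ) : Set (Eucl n) :=
  {x | ∀ i, |x i - ((z i : ℝ) + 1 / 2) * (2:ℝ) ^ (-k)| < (17 / 16) * ((2:ℝ) ^ (-k) / 2)}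

/-- The dilation `K·Q` of the cube `Q` about its center. -/
def cubeDil {n : ℕ} (K : ℝ) (k : ℤ) (z : Fin n → ℤ) : Set (Eucl n) :=
  {x | ∀ i, |x i - ((z i : ℝ) + 1 / 2) * (2:ℝ) ^ (-k)| ≤ K * ((2:ℝ) ^ (-k) / 2)}

/-- Distance between two sets. -/
def setDist {n : ℕ} (A B : Set (Eucl n)) : ℝ :=
  sInf (Set.image2 dist A B)

/-- A tree-covering of a bounded domain `Ω` obtained from a Whitney decomposition,
with `U_t = (17/16)·int(Q_t)` (Remark 3.2). -/
structure WhitneyTreeCovering (n : ℕ) (Ω : Set (Eucl n)) where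
  ι : Type
  countable : Countable ι
  kk : ι → ℤ
  zz : ι → Fin n → ℤ
  disjQ : ∀ s t : ι, s ≠ t →
    Disjoint (interior (cubeQ (kk s) (zz s))) (interior (cubeQ (kk t) (zz t)))
  unionQ : (⋃ t : ι, cubeQ (kk t) (zz t)) = Ω
  whitney₁ : ∀ t, Metric.diam (cubeQ (kk t) (zz t))
    ≤ setDist (cubeQ (kk t) (zz t)) (frontier Ω)
  whitney₂ : ∀ t, setDist (cubeQ (kk t) (zz t)) (frontier Ω)
    ≤ 4 * Metric.diam (cubeQ (kk t) (zz t))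
  neighbor : ∀ s t : ι, (cubeQ (kk s) (zz s) ∩ cubeQ (kk t) (zz t)).Nonempty →
    Metric.diam (cubeQ (kk t) (zz t)) ≤ 4 * Metric.diam (cubeQ (kk s) (zz s))
  root : ι
  parent : ι → ι
  parent_root : parent root = root
  reach : ∀ t : ι, ∃ m : ℕ, parent^[m] t = root
  C₁ : ℝ
  one_le_C₁ : 1 ≤ C₁
  cover : ∀ᵐ x ∂(volume : Measure (Eucl n)),
    (x ∈ Ω → 1 ≤ ∑' t : ι, Set.indicator (cubeU (kk t) (zz t)) (fun _ => (1:ℝ)) x) ∧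
    (∑' t : ι, Set.indicator (cubeU (kk t) (zz t)) (fun _ => (1:ℝ)) x
      ≤ C₁ * Set.indicator Ω (fun _ => (1:ℝ)) x)
  Bt : ι → Set (Eucl n)
  Bt_open : ∀ t, IsOpen (Bt t)
  Bt_sub : ∀ t, t ≠ root → Bt t ⊆ cubeU (kk t) (zz t) ∩ cubeU (kk (parent t)) (zz (parent t))
  Bt_disj : ∀ s t, s ≠ root → t ≠ root → s ≠ t → Disjoint (Bt s) (Bt t)
  C₂ : ℝ
  meas_ratio : ∀ t, t ≠ root →
    (volume (cubeU (kk t) (zz t))).toReal ≤ C₂ * (volume (Bt t)).toReal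

/-- The Whitney cube `Q_t`. -/
def WhitneyTreeCovering.Q {n : ℕ} {Ω : Set (Eucl n)} (T : WhitneyTreeCovering n Ω)
    (t : T.ι) : Set (Eucl n) := cubeQ (T.kk t) (T.zz t)

/-- The expanded cube `U_t`. -/
def WhitneyTreeCovering.U {n : ℕ} {Ω : Set (Eucl n)} (T : WhitneyTreeCovering n Ω)
    (t : T.ι) : Set (Eucl n) := cubeU (T.kk t) (T.zz t)

/-- The shadow `W_t = ⋃_{s ⪰ t} U_s`. -/
def WhitneyTreeCovering.shadow {n : ℕ} {Ω : Set (Eucl n)} (T : WhitneyTreeCovering n Ω)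
    (t : T.ι) : Set (Eucl n) :=
  ⋃ s ∈ {s : T.ι | ∃ m : ℕ, T.parent^[m] s = t}, T.U s

/-- The characteristic function of a set, as a real valued function. -/
def charFun {n : ℕ} (A : Set (Eucl n)) : Eucl n → ℝ :=
  Set.indicator A (fun _ => (1:ℝ))
/-- The averaging-type operator `T_{p(·)}` of Lemma 4.1. -/
def Tp {n : ℕ} {Ω : Set (Eucl n)} (T : WhitneyTreeCovering n Ω)
    (p f : Eucl n → ℝ) (x : Eucl n) : ℝ :=
  ∑' t : T.ι,
    Set.indicator (T.U t)
      (fun _ => luxNorm Ω p (Set.indicator (T.U t) f) / luxNorm Ω p (charFun (T.U t))) x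

theorem isOpen_cubeU {n : ℕ} (k : ℤ) (z : Fin n → ℤ) : IsOpen (cubeU k z) := by
  simp only [cubeU, ofPred_forall]
  exact isOpen_iInter_of_finite fun i => isOpen_lt (by fun_prop) continuous_const

theorem cubeQ_subset_cubeU {n : ℕ} (k : ℤ) (z : Fin n → ℤ) : cubeQ k z ⊆ cubeU k z := by
  intro x hx i
  have hs : (0 : ℝ) < 2 ^ (-k) := by positivity
  have := hx i
  linarith

theorem volume_cubeQ {n : ℕ} (k : ℤ) (z : Fin n → ℤ) :
    volume (cubeQ k z) = ENNReal.ofReal (((2 : ℝ) ^ (-k)) ^ n) := by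
  have hs : (0 : ℝ) < 2 ^ (-k) := by positivity
  have hpre : cubeQ k z = (WithLp.ofLp : Eucl n → Fin n → ℝ) ⁻¹'
      Icc (fun i => ((z i : ℝ) + 1 / 2) * (2 : ℝ) ^ (-k) - (2 : ℝ) ^ (-k) / 2)
        (fun i => ((z i : ℝ) + 1 / 2) * (2 : ℝ) ^ (-k) + (2 : ℝ) ^ (-k) / 2) := by
    ext x
    simp only [cubeQ, mem_ofPred_eq, mem_preimage, mem_Icc, Pi.le_def, abs_le, ← forall_and]
    refine forall_congr' fun i => ?_
    constructor <;> rintro ⟨h₁, h₂⟩ <;> constructor <;> linarith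
  rw [hpre, (PiLp.volume_preserving_ofLp (Fin n)).measure_preimage
    measurableSet_Icc.nullMeasurableSet, Real.volume_Icc_pi, ENNReal.ofReal_pow hs.le]
  simp [Finset.prod_const]

theorem dist_le_sqrt_mul {n : ℕ} {x y : Eucl n} {r : ℝ} (hr : 0 ≤ r)
    (h : ∀ i, |x i - y i| ≤ r) : dist x y ≤ √n * r := by
  rw [EuclideanSpace.dist_eq, ← Real.sqrt_sq hr, ← Real.sqrt_mul (by positivity)]
  refine Real.sqrt_le_sqrt ((Finset.sum_le_card_nsmul _ _ (r ^ 2) fun i _ => ?_).trans ?_)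
  · rw [Real.dist_eq]
    exact pow_le_pow_left₀ (abs_nonneg _) (h i) 2
  · simp

/-- The point all of whose coordinates sit at signed distance `a` from the center of the cube. -/
def cubePoint {n : ℕ} (k : ℤ) (z : Fin n → ℤ) (a : ℝ) : Eucl n :=
  WithLp.toLp 2 fun i => ((z i : ℝ) + 1 / 2) * (2 : ℝ) ^ (-k) + a

theorem cubePoint_mem_cubeQ {n : ℕ} (k : ℤ) (z : Fin n → ℤ) {a : ℝ}
    (ha : |a| ≤ (2 : ℝ) ^ (-k) / 2) : cubePoint k z a ∈ cubeQ k z := by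
  intro i
  simpa [cubePoint] using ha

theorem dist_le_of_mem_cubeQ {n : ℕ} {k : ℤ} {z : Fin n → ℤ} {x y : Eucl n}
    (hx : x ∈ cubeQ k z) (hy : y ∈ cubeQ k z) : dist x y ≤ √n * (2 : ℝ) ^ (-k) := by
  refine dist_le_sqrt_mul (by positivity) fun i => ?_
  have h₁ := abs_le.1 (hx i)
  have h₂ := abs_le.1 (hy i)
  exact abs_le.2 ⟨by linarith, by linarith⟩

theorem isBounded_cubeQ {n : ℕ} (k : ℤ) (z : Fin n → ℤ) : Bornology.IsBounded (cubeQ k z) :=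
  Metric.isBounded_iff.2 ⟨_, fun _ hx _ hy => dist_le_of_mem_cubeQ hx hy⟩

theorem diam_cubeQ {n : ℕ} (k : ℤ) (z : Fin n → ℤ) :
    Metric.diam (cubeQ k z) = √n * (2 : ℝ) ^ (-k) := by
  have hs : (0 : ℝ) < 2 ^ (-k) := by positivity
  refine le_antisymm (diam_le_of_forall_dist_le (by positivity)
    fun _ hx _ hy => dist_le_of_mem_cubeQ hx hy) ?_
  have hmem (a : ℝ) (ha : |a| = (2 : ℝ) ^ (-k) / 2) := cubePoint_mem_cubeQ k z ha.le
  refine le_trans (le_of_eq ?_) (dist_le_diam_of_mem (isBounded_cubeQ k z)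
    (hmem ((2 : ℝ) ^ (-k) / 2) (abs_of_pos (by positivity)))
    (hmem (-((2 : ℝ) ^ (-k) / 2)) (by rw [abs_neg, abs_of_pos (by positivity)])))
  have hdist (c : ℝ) : dist (c + (2 : ℝ) ^ (-k) / 2) (c + -((2 : ℝ) ^ (-k) / 2)) =
      (2 : ℝ) ^ (-k) := by
    rw [Real.dist_eq, show c + (2 : ℝ) ^ (-k) / 2 - (c + -((2 : ℝ) ^ (-k) / 2)) =
      (2 : ℝ) ^ (-k) by ring, abs_of_pos hs]
  rw [EuclideanSpace.dist_eq]
  simp only [cubePoint, hdist, Finset.sum_const, Finset.card_univ, Fintype.card_fin,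
    nsmul_eq_mul]
  rw [Real.sqrt_mul (by positivity), Real.sqrt_sq hs.le]

theorem setDist_le_infDist {n : ℕ} {A B : Set (Eucl n)} {x : Eucl n} (hx : x ∈ A)
    (hB : B.Nonempty) : setDist A B ≤ infDist x B := by
  refine (le_infDist hB).2 fun {y} hy => csInf_le ⟨0, ?_⟩ (mem_image2_of_mem hx hy)
  rintro _ ⟨_, _, _, _, rfl⟩
  exact dist_nonneg

theorem infDist_le_setDist_add_diam {n : ℕ} {A B : Set (Eucl n)} {x : Eucl n} (hx : x ∈ A)
    (hA : Bornology.IsBounded A) (hB : B.Nonempty) :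
    infDist x B ≤ setDist A B + Metric.diam A := by
  rw [← sub_le_iff_le_add]
  refine le_csInf (Nonempty.image2 ⟨x, hx⟩ hB) ?_
  rintro _ ⟨a, ha, b, hb, rfl⟩
  have h₁ := infDist_le_dist_of_mem (x := x) hb
  have h₂ := dist_triangle x a b
  have h₃ := dist_le_diam_of_mem hA hx ha
  linarith

section Geometry

variable {n : ℕ} {Ω : Set (Eucl n)} (T : WhitneyTreeCovering n Ω)

theorem WhitneyTreeCovering.Q_subset_inter (t : T.ι) : T.Q t ⊆ T.U t ∩ Ω := fun _ hx =>
  ⟨cubeQ_subset_cubeU _ _ hx, T.unionQ ▸ mem_iUnion_of_mem t hx⟩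

theorem WhitneyTreeCovering.measurableSet_U (t : T.ι) : MeasurableSet (T.U t) :=
  (isOpen_cubeU _ _).measurableSet

theorem WhitneyTreeCovering.pow_le_volume (hΩ : volume Ω ≠ ⊤) (t : T.ι) :
    ((2 : ℝ) ^ (-T.kk t)) ^ n ≤ (volume (T.U t ∩ Ω)).toReal := by
  rw [← ENNReal.ofReal_le_iff_le_toReal (measure_ne_top_of_subset inter_subset_right hΩ),
    ← volume_cubeQ _ (T.zz t)]
  exact measure_mono (T.Q_subset_inter t)

/-- The center of the cube `Q_t`. -/
def WhitneyTreeCovering.center (t : T.ι) : Eucl n := cubePoint (T.kk t) (T.zz t) 0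

theorem WhitneyTreeCovering.center_mem (t : T.ι) : T.center t ∈ T.Q t :=
  cubePoint_mem_cubeQ _ _ (by rw [abs_zero]; positivity)

theorem WhitneyTreeCovering.le_bdist_center (hΩ : (frontier Ω).Nonempty) (t : T.ι) :
    √n * (2 : ℝ) ^ (-T.kk t) ≤ bdist Ω (T.center t) := by
  rw [← diam_cubeQ _ (T.zz t)]
  exact (T.whitney₁ t).trans (setDist_le_infDist (T.center_mem t) hΩ)

theorem WhitneyTreeCovering.bdist_center_le (hΩ : (frontier Ω).Nonempty) (t : T.ι) :
    bdist Ω (T.center t) ≤ 5 * (√n * (2 : ℝ) ^ (-T.kk t)) := by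
  rw [← diam_cubeQ _ (T.zz t)]
  have h₁ := infDist_le_setDist_add_diam (T.center_mem t) (isBounded_cubeQ _ _) hΩ
  have h₂ := T.whitney₂ t
  simp only [WhitneyTreeCovering.Q] at h₁
  simp only [bdist]
  linarith

theorem WhitneyTreeCovering.U_subset_ballB (hn : 0 < n) (hΩ : (frontier Ω).Nonempty) {τ : ℝ}
    (hτ : 1 ≤ τ) (t : T.ι) : T.U t ⊆ ballB Ω τ (T.center t) := by
  intro x hx
  have hs : (0 : ℝ) < 2 ^ (-T.kk t) := by positivity
  have hpos : 0 < √n * (2 : ℝ) ^ (-T.kk t) := by positivity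
  have h₁ := T.le_bdist_center hΩ t
  have h₂ : dist x (T.center t) ≤ √n * (17 / 16 * ((2 : ℝ) ^ (-T.kk t) / 2)) :=
    dist_le_sqrt_mul (by positivity) fun i => by
      simpa [WhitneyTreeCovering.center, cubePoint] using (hx i).le
  rw [ballB, mem_ball]
  nlinarith

end Geometry

/-- An exponent of size `O(1 / log (1 / δ))` keeps powers of a length comparable to `δ` away
from zero. -/
theorem exp_le_pow_rpow_of_le_div_log {n : ℕ} {C₀ A δ s e : ℝ} (hs : 0 < s) (hA : 1 ≤ A)
    (hδ₀ : 0 < δ) (hδ : δ ≤ 1 / 2) (hδs : δ ≤ A * s) (he₀ : 0 ≤ e)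
    (he : e ≤ C₀ / (-Real.log δ)) :
    Real.exp (-(n * (C₀ * (1 + Real.log A / Real.log 2)))) ≤ (s ^ n) ^ e := by
  have hlog2 : 0 < Real.log 2 := Real.log_pos one_lt_two
  have hL : Real.log 2 ≤ -Real.log δ := by
    rw [← Real.log_inv]
    exact Real.log_le_log two_pos ((le_inv_comm₀ two_pos hδ₀).2 (by linarith))
  have hlogs : -Real.log s ≤ Real.log A + -Real.log δ := by
    have := Real.log_le_log hδ₀ hδs
    rw [Real.log_mul (by positivity) hs.ne'] at this
    linarith
  have hlogA : 0 ≤ Real.log A := Real.log_nonneg hA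
  have heL : e * -Real.log δ ≤ C₀ := (le_div_iff₀ (hlog2.trans_le hL)).1 he
  have heA : e * Real.log A ≤ C₀ * (Real.log A / Real.log 2) := by
    rw [← mul_div_assoc, le_div_iff₀ hlog2, mul_right_comm]
    exact mul_le_mul_of_nonneg_right ((mul_le_mul_of_nonneg_left hL he₀).trans heL) hlogA
  have key : e * -Real.log s ≤ C₀ * (1 + Real.log A / Real.log 2) := by
    have := mul_le_mul_of_nonneg_left hlogs he₀
    linarith
  rw [Real.rpow_def_of_pos (by positivity), Real.log_pow]
  refine Real.exp_le_exp.2 ?_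
  have := mul_le_mul_of_nonneg_left key (Nat.cast_nonneg (α := ℝ) n)
  linarith

theorem frontier_nonempty_of_isBounded {n : ℕ} (hn : 0 < n) {Ω : Set (Eucl n)}
    (hne : Ω.Nonempty) (hb : Bornology.IsBounded Ω) : (frontier Ω).Nonempty := by
  have : Nonempty (Fin n) := ⟨⟨0, hn⟩⟩
  refine nonempty_frontier_iff.2 ⟨hne, ?_⟩
  rintro rfl
  exact NormedSpace.unbounded_univ ℝ (Eucl n) hb

theorem ae_essInfOn_le_and_le_essSupOn {n : ℕ} {Ω A : Set (Eucl n)} {p : Eucl n → ℝ}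
    (hΩ : MeasurableSet Ω) (hA : A ⊆ Ω) (hp1 : ∀ x ∈ Ω, 1 ≤ p x) {M : ℝ}
    (hM : ∀ᵐ x ∂(volume.restrict Ω), p x ≤ M) :
    ∀ᵐ x ∂(volume.restrict A), essInfOn p A ≤ p x ∧ p x ≤ essSupOn p A := by
  have hp1' : ∀ᵐ x ∂(volume.restrict A), 1 ≤ p x :=
    ae_restrict_of_ae_restrict_of_subset hA ((ae_restrict_iff' hΩ).2 (ae_of_all _ hp1))
  have h₁ : IsBoundedUnder (· ≤ ·) (ae (volume.restrict A)) p :=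
    ⟨M, eventually_map.2 (ae_restrict_of_ae_restrict_of_subset hA hM)⟩
  have h₂ : IsBoundedUnder (· ≥ ·) (ae (volume.restrict A)) p := ⟨1, eventually_map.2 hp1'⟩
  filter_upwards [ae_le_essSup h₁, ae_essInf_le h₂] with x hx₁ hx₂ using ⟨hx₂, hx₁⟩

theorem WhitneyTreeCovering.exists_le_volume_rpow_oscillation {n : ℕ} {Ω : Set (Eucl n)}
    (T : WhitneyTreeCovering n Ω) (hΩo : IsOpen Ω) (hne : Ω.Nonempty)
    (hΩb : Bornology.IsBounded Ω) {p : Eucl n → ℝ} (hp1 : ∀ x ∈ Ω, 1 ≤ p x) {M : ℝ}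
    (hM : ∀ᵐ x ∂(volume.restrict Ω), p x ≤ M) {τ : ℝ} (hτ : 1 ≤ τ) {C₀ : ℝ} (hC₀ : 0 < C₀)
    (hLH : BoundaryLH Ω p τ C₀) :
    ∃ c : ℝ, 0 < c ∧ c ≤ 1 ∧ ∀ t, ∃ q r : ℝ, 1 ≤ q ∧ q ≤ r ∧
      (∀ᵐ x ∂(volume.restrict (T.U t ∩ Ω)), q ≤ p x ∧ p x ≤ r) ∧
      ((volume (T.U t ∩ Ω)).toReal < 1 → c ≤ (volume (T.U t ∩ Ω)).toReal ^ (r - q)) := by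
  have hvol := T.pow_le_volume hΩb.measure_lt_top.ne
  have hp1' (t : T.ι) : ∀ᵐ x ∂(volume.restrict (T.U t ∩ Ω)), 1 ≤ p x :=
    ae_restrict_of_ae_restrict_of_subset inter_subset_right
      ((ae_restrict_iff' hΩo.measurableSet).2 (ae_of_all _ hp1))
  have hM' (t : T.ι) : ∀ᵐ x ∂(volume.restrict (T.U t ∩ Ω)), 1 ≤ p x ∧ p x ≤ max M 1 := by
    filter_upwards [hp1' t, ae_restrict_of_ae_restrict_of_subset inter_subset_right hM]
      with x h₁ h₂ using ⟨h₁, h₂.trans (le_max_left _ _)⟩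
  rcases Nat.eq_zero_or_pos n with rfl | hn
  · refine ⟨1, one_pos, le_rfl, fun t => ⟨1, max M 1, le_rfl, le_max_right _ _, hM' t, fun h => ?_⟩⟩
    have := hvol t
    rw [pow_zero] at this
    linarith
  have hfr := frontier_nonempty_of_isBounded hn hne hΩb
  have hsqrt : 1 ≤ √n := by
    rw [Real.one_le_sqrt]
    exact_mod_cast hn
  set A : ℝ := 5 * √n * τ with hA_def
  have hA : 1 ≤ A := by nlinarith
  set c₁ := Real.exp (-(n * (C₀ * (1 + Real.log A / Real.log 2))))
  set c₂ : ℝ := (((2 * A)⁻¹) ^ n) ^ (max M 1 - 1)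
  have hc₂ : 0 < c₂ := by positivity
  refine ⟨min (min c₁ c₂) 1, lt_min (lt_min (Real.exp_pos _) hc₂) one_pos, min_le_right _ _,
    fun t => ?_⟩
  have hs : (0 : ℝ) < 2 ^ (-T.kk t) := by positivity
  have hτ₀ : 0 < τ := by linarith
  have hd₁ := T.le_bdist_center hfr t
  have hd₀ : 0 < bdist Ω (T.center t) := lt_of_lt_of_le (by positivity) hd₁
  have hd₂ : τ * bdist Ω (T.center t) ≤ A * 2 ^ (-T.kk t) := by
    have := mul_le_mul_of_nonneg_left (T.bdist_center_le hfr t) hτ₀.le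
    rw [hA_def]
    linarith
  rcases le_or_gt (τ * bdist Ω (T.center t)) (1 / 2) with hsmall | hbig
  · set B := ballB Ω τ (T.center t) ∩ Ω
    have hosc := hLH _ (T.Q_subset_inter t (T.center_mem t)).2 hsmall
    set q := max (essInfOn p B) 1
    set r := max (essSupOn p B) q
    have hsub : T.U t ∩ Ω ⊆ B := inter_subset_inter_left _ (T.U_subset_ballB hn hfr hτ t)
    refine ⟨q, r, le_max_right _ _, le_max_right _ _, ?_, fun h => ?_⟩
    · filter_upwards [hp1' t, ae_restrict_of_ae_restrict_of_subset hsub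
        (ae_essInfOn_le_and_le_essSupOn hΩo.measurableSet inter_subset_right hp1 hM)]
        with x h₁ h₂ using ⟨max_le h₂.1 h₁, h₂.2.trans (le_max_left _ _)⟩
    · have hL : 0 ≤ C₀ / -Real.log (τ * bdist Ω (T.center t)) :=
        div_nonneg hC₀.le (neg_nonneg.2 (Real.log_nonpos (by positivity) (by linarith)))
      have he : r - q ≤ C₀ / -Real.log (τ * bdist Ω (T.center t)) := by
        rw [sub_le_iff_le_add]
        refine max_le ?_ (by linarith)
        have := le_max_left (essInfOn p B) 1
        linarith
      have he₀ : 0 ≤ r - q := sub_nonneg.2 (le_max_right _ _)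
      calc min (min c₁ c₂) 1 ≤ c₁ := (min_le_left _ _).trans (min_le_left _ _)
        _ ≤ (((2 : ℝ) ^ (-T.kk t)) ^ n) ^ (r - q) :=
          exp_le_pow_rpow_of_le_div_log hs hA (by positivity) hsmall hd₂ he₀ he
        _ ≤ _ := Real.rpow_le_rpow (by positivity) (hvol t) he₀
  · refine ⟨1, max M 1, le_rfl, le_max_right _ _, hM' t, fun h => ?_⟩
    have he₀ : 0 ≤ max M 1 - 1 := sub_nonneg.2 (le_max_right _ _)
    have hlow : (2 * A)⁻¹ ≤ (2 : ℝ) ^ (-T.kk t) := by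
      rw [inv_le_iff_one_le_mul₀ (by positivity)]
      linarith
    calc min (min c₁ c₂) 1 ≤ c₂ := (min_le_left _ _).trans (min_le_right _ _)
      _ ≤ _ := Real.rpow_le_rpow (by positivity)
        ((pow_le_pow_left₀ (by positivity) hlow n).trans (hvol t)) he₀

theorem luxNorm_nonneg {n : ℕ} (A : Set (Eucl n)) (p f : Eucl n → ℝ) : 0 ≤ luxNorm A p f :=
  Real.sInf_nonneg fun _ hl => hl.1.le

theorem luxNorm_le {n : ℕ} {A : Set (Eucl n)} {p f : Eucl n → ℝ} {l : ℝ} (hl : 0 < l)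
    (h : ∫⁻ x in A, ENNReal.ofReal ((|f x| / l) ^ p x) ≤ 1) : luxNorm A p f ≤ l :=
  csInf_le ⟨0, fun _ h => h.1.le⟩ ⟨hl, h⟩

section Local

variable {n : ℕ} {Ω U : Set (Eucl n)} {p f : Eucl n → ℝ} {q r c V l : ℝ}

theorem setLIntegral_indicator_modular (hΩ : MeasurableSet Ω) (hU : MeasurableSet U)
    (hp1 : ∀ x ∈ Ω, 1 ≤ p x) (f : Eucl n → ℝ) (l : ℝ) :
    ∫⁻ x in Ω, ENNReal.ofReal ((|U.indicator f x| / l) ^ p x) =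
      ∫⁻ x in U ∩ Ω, ENNReal.ofReal ((|f x| / l) ^ p x) := by
  rw [← Measure.restrict_restrict hU, ← lintegral_indicator hU]
  refine setLIntegral_congr_fun hΩ fun x hx => ?_
  by_cases hxU : x ∈ U
  · simp [hxU]
  · have := hp1 x hx
    simp [hxU, Real.zero_rpow (by linarith : p x ≠ 0)]

theorem ae_mul_volume_le_luxNorm_charFun_rpow (hΩ : MeasurableSet Ω) (hU : MeasurableSet U)
    (hp1 : ∀ x ∈ Ω, 1 ≤ p x) (hfin : volume (U ∩ Ω) ≠ ⊤) (hV : 1 ≤ V)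
    (hmV : (volume (U ∩ Ω)).toReal ≤ V) (hc₀ : 0 < c) (hc₁ : c ≤ 1) (hq : 1 ≤ q) (hqr : q ≤ r)
    (hqpr : ∀ᵐ x ∂(volume.restrict (U ∩ Ω)), q ≤ p x ∧ p x ≤ r)
    (hosc : (volume (U ∩ Ω)).toReal < 1 → c ≤ (volume (U ∩ Ω)).toReal ^ (r - q)) :
    ∀ᵐ x ∂(volume.restrict (U ∩ Ω)),
      c / V * (volume (U ∩ Ω)).toReal ≤ luxNorm Ω p (charFun U) ^ p x := by
  set m := (volume (U ∩ Ω)).toReal with hm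
  have hm₀ : 0 ≤ m := ENNReal.toReal_nonneg
  have hV₀ : 0 < V := by linarith
  have hmod (l : ℝ) : ∫⁻ x in Ω, ENNReal.ofReal ((|charFun U x| / l) ^ p x) =
      ∫⁻ x in U ∩ Ω, ENNReal.ofReal ((1 / l) ^ p x) := by
    simpa [_root_.charFun] using setLIntegral_indicator_modular hΩ hU hp1 (fun _ => (1 : ℝ)) l
  filter_upwards [hqpr] with x hx
  have hpx : 0 < p x := by linarith
  have hcm : 0 ≤ c / V * m := by positivity
  rw [← Real.rpow_inv_le_iff_of_pos hcm (luxNorm_nonneg _ _ _) hpx]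
  refine le_csInf ⟨V, hV₀, ?_⟩ ?_
  · rw [hmod]
    calc ∫⁻ x in U ∩ Ω, ENNReal.ofReal ((1 / V) ^ p x)
        ≤ ∫⁻ _ in U ∩ Ω, ENNReal.ofReal (1 / V) := by
          refine lintegral_mono_ae ?_
          filter_upwards [hqpr] with y hy
          refine ENNReal.ofReal_le_ofReal ?_
          exact Real.rpow_le_self_of_le_one (by positivity) ((div_le_one hV₀).2 hV)
            (hq.trans hy.1)
      _ = ENNReal.ofReal (1 / V * m) := by
          rw [setLIntegral_const, ENNReal.ofReal_mul (by positivity), hm,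
            ENNReal.ofReal_toReal hfin]
      _ ≤ 1 := by
          rw [ENNReal.ofReal_le_one, one_div, inv_mul_le_iff₀ hV₀, mul_one]
          exact hmV
  · rintro l ⟨hl, hint⟩
    rw [Real.rpow_inv_le_iff_of_pos hcm hl.le hpx]
    rcases le_or_gt 1 l with h1l | hl1
    · calc c / V * m ≤ 1 / V * V := by gcongr
        _ = 1 := by field_simp
        _ ≤ l ^ p x := Real.one_le_rpow h1l hpx.le
    · rw [hmod] at hint
      have hmq : m ≤ l ^ q := by
        have h₁ : ENNReal.ofReal ((1 / l) ^ q * m) ≤ 1 := by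
          refine le_trans ?_ hint
          rw [ENNReal.ofReal_mul (by positivity), hm, ENNReal.ofReal_toReal hfin,
            ← setLIntegral_const]
          refine lintegral_mono_ae ?_
          filter_upwards [hqpr] with y hy
          exact ENNReal.ofReal_le_ofReal
            (Real.rpow_le_rpow_of_exponent_le ((one_le_div hl).2 hl1.le) hy.1)
        rw [ENNReal.ofReal_le_one, one_div, Real.inv_rpow hl.le,
          inv_mul_le_iff₀ (by positivity), mul_one] at h₁
        exact h₁
      have hq₀ : 0 < q := by linarith
      have hm1 : m < 1 := hmq.trans_lt (Real.rpow_lt_one hl.le hl1 hq₀)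
      calc c / V * m ≤ c * m := by gcongr; exact div_le_self hc₀.le hV
        _ ≤ m ^ (r - q) * m := by gcongr; exact hosc hm1
        _ ≤ (l ^ q) ^ (r - q) * l ^ q := by gcongr
        _ ≤ l ^ (r - q) * l ^ q := by
          have hlq : l ^ q ≤ l := Real.rpow_le_self_of_le_one hl.le hl1.le hq
          gcongr
        _ = l ^ r := by rw [← Real.rpow_add hl, sub_add_cancel]
        _ ≤ l ^ p x := Real.rpow_le_rpow_of_exponent_ge hl hl1.le hx.2

theorem luxNorm_indicator_div_le (hΩ : MeasurableSet Ω) (hU : MeasurableSet U)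
    (hp1 : ∀ x ∈ Ω, 1 ≤ p x) (hl : 0 < l)
    (hpr : ∀ᵐ x ∂(volume.restrict (U ∩ Ω)), p x ≤ r) {k : ℝ} (hk₀ : 0 < k) (hk₁ : k ≤ 1)
    (hk : ∫⁻ x in U ∩ Ω, ENNReal.ofReal ((|f x| / l) ^ p x) ≤ ENNReal.ofReal (k ^ r)) :
    luxNorm Ω p (U.indicator f) / l ≤ k := by
  rw [div_le_iff₀ hl]
  refine luxNorm_le (by positivity) ?_
  rw [setLIntegral_indicator_modular hΩ hU hp1]
  calc ∫⁻ x in U ∩ Ω, ENNReal.ofReal ((|f x| / (k * l)) ^ p x)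
      ≤ ∫⁻ x in U ∩ Ω, ENNReal.ofReal ((k ^ r)⁻¹) * ENNReal.ofReal ((|f x| / l) ^ p x) := by
        refine lintegral_mono_ae ?_
        filter_upwards [hpr] with x hx
        rw [← ENNReal.ofReal_mul (by positivity)]
        refine ENNReal.ofReal_le_ofReal ?_
        rw [show |f x| / (k * l) = k⁻¹ * (|f x| / l) by field_simp,
          Real.mul_rpow (by positivity) (by positivity), Real.inv_rpow hk₀.le]
        gcongr ?_⁻¹ * _
        exact Real.rpow_le_rpow_of_exponent_ge hk₀ hk₁ hx
    _ = ENNReal.ofReal ((k ^ r)⁻¹) * ∫⁻ x in U ∩ Ω, ENNReal.ofReal ((|f x| / l) ^ p x) :=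
        lintegral_const_mul' _ _ ENNReal.ofReal_ne_top
    _ ≤ ENNReal.ofReal ((k ^ r)⁻¹) * ENNReal.ofReal (k ^ r) := by gcongr
    _ = 1 := by
        rw [← ENNReal.ofReal_mul (by positivity), inv_mul_cancel₀ (by positivity),
          ENNReal.ofReal_one]

theorem luxNorm_indicator_div_rpow_le (hΩ : MeasurableSet Ω) (hU : MeasurableSet U)
    (hp1 : ∀ x ∈ Ω, 1 ≤ p x) (hl : 0 < l) (hr : 1 ≤ r)
    (hpr : ∀ᵐ x ∂(volume.restrict (U ∩ Ω)), p x ≤ r)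
    (hmod : ∫⁻ x in U ∩ Ω, ENNReal.ofReal ((|f x| / l) ^ p x) ≤ 1) :
    (luxNorm Ω p (U.indicator f) / l) ^ r ≤
      (∫⁻ x in U ∩ Ω, ENNReal.ofReal ((|f x| / l) ^ p x)).toReal := by
  have hr₀ : 0 < r := by linarith
  set R := ∫⁻ x in U ∩ Ω, ENNReal.ofReal ((|f x| / l) ^ p x) with hR
  set a := luxNorm Ω p (U.indicator f) / l with ha
  have ha₀ : 0 ≤ a := div_nonneg (luxNorm_nonneg _ _ _) hl.le
  have hRtop : R ≠ ⊤ := ne_top_of_le_ne_top ENNReal.one_ne_top hmod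
  have hR1 : R.toReal ≤ 1 := by
    simpa using ENNReal.toReal_mono ENNReal.one_ne_top hmod
  have key (k : ℝ) (hk₀ : 0 < k) (hk₁ : k ≤ 1) (hk : R ≤ ENNReal.ofReal (k ^ r)) : a ≤ k :=
    luxNorm_indicator_div_le hΩ hU hp1 hl hpr hk₀ hk₁ hk
  rcases ENNReal.toReal_nonneg.eq_or_lt with h0 | hpos
  · have hRz : R = 0 := ((ENNReal.toReal_eq_zero_iff _).1 h0.symm).resolve_right hRtop
    have haz : a = 0 := by
      by_contra hne
      have hapos : 0 < a := lt_of_le_of_ne ha₀ (Ne.symm hne)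
      have ha1 : a ≤ 1 := key 1 one_pos le_rfl (by simp [hRz])
      have := key (a / 2) (by positivity) (by linarith) (by simp [hRz])
      linarith
    rw [haz, Real.zero_rpow hr₀.ne']
    exact ENNReal.toReal_nonneg
  · rw [← Real.le_rpow_inv_iff_of_pos ha₀ hpos.le hr₀]
    refine key _ (by positivity) (Real.rpow_le_one hpos.le hR1 (by positivity)) ?_
    rw [Real.rpow_inv_rpow hpos.le hr₀.ne', ENNReal.ofReal_toReal hRtop]

theorem setLIntegral_luxNorm_ratio_rpow_le (hΩ : MeasurableSet Ω) (hU : MeasurableSet U)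
    (hp1 : ∀ x ∈ Ω, 1 ≤ p x) (hpos : 0 < (volume (U ∩ Ω)).toReal) (hV : 1 ≤ V)
    (hmV : (volume (U ∩ Ω)).toReal ≤ V) (hc₀ : 0 < c) (hc₁ : c ≤ 1) (hq : 1 ≤ q) (hqr : q ≤ r)
    (hqpr : ∀ᵐ x ∂(volume.restrict (U ∩ Ω)), q ≤ p x ∧ p x ≤ r)
    (hosc : (volume (U ∩ Ω)).toReal < 1 → c ≤ (volume (U ∩ Ω)).toReal ^ (r - q))
    (hl : 0 < l) (hmod : ∫⁻ x in U ∩ Ω, ENNReal.ofReal ((|f x| / l) ^ p x) ≤ 1) :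
    ∫⁻ x in U ∩ Ω, ENNReal.ofReal
        ((luxNorm Ω p (U.indicator f) / luxNorm Ω p (charFun U) / l) ^ p x) ≤
      ENNReal.ofReal (V / c ^ 2) *
        ((∫⁻ x in U ∩ Ω, ENNReal.ofReal ((|f x| / l) ^ p x)) + volume (U ∩ Ω)) := by
  have hfin : volume (U ∩ Ω) ≠ ⊤ := (ENNReal.toReal_pos_iff.1 hpos).2.ne
  have hlow := ae_mul_volume_le_luxNorm_charFun_rpow hΩ hU hp1 hfin hV hmV hc₀ hc₁ hq hqr hqpr hosc
  have hpr : ∀ᵐ x ∂(volume.restrict (U ∩ Ω)), p x ≤ r := hqpr.mono fun _ h => h.2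
  have har := luxNorm_indicator_div_rpow_le (f := f) hΩ hU hp1 hl (hq.trans hqr) hpr hmod
  have ha1 : luxNorm Ω p (U.indicator f) / l ≤ 1 :=
    luxNorm_indicator_div_le hΩ hU hp1 hl hpr one_pos le_rfl (by simpa using hmod)
  set R := ∫⁻ x in U ∩ Ω, ENNReal.ofReal ((|f x| / l) ^ p x) with hR
  set a := luxNorm Ω p (U.indicator f) / l with ha
  set b := luxNorm Ω p (charFun U)
  set m := (volume (U ∩ Ω)).toReal with hm
  have ha₀ : 0 ≤ a := div_nonneg (luxNorm_nonneg _ _ _) hl.le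
  have hb₀ : 0 ≤ b := luxNorm_nonneg _ _ _
  have hRtop : R ≠ ⊤ := ne_top_of_le_ne_top ENNReal.one_ne_top hmod
  have hV₀ : 0 < V := by linarith
  have hR₀ : 0 ≤ R.toReal := ENNReal.toReal_nonneg
  have haq : a ^ q ≤ (R.toReal + m) / c := by
    rw [le_div_iff₀ hc₀]
    rcases le_or_gt a m with ham | hma
    · have h₁ : a ^ q ≤ a := Real.rpow_le_self_of_le_one ha₀ ha1 hq
      have h₂ : a ^ q * c ≤ a ^ q := mul_le_of_le_one_right (by positivity) hc₁
      linarith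
    · have hapos : 0 < a := hpos.trans hma
      have h₁ : a ^ q * c ≤ a ^ r := by
        calc a ^ q * c ≤ a ^ q * m ^ (r - q) := by gcongr; exact hosc (hma.trans_le ha1)
          _ ≤ a ^ q * a ^ (r - q) := by gcongr
          _ = a ^ r := by rw [← Real.rpow_add hapos, add_sub_cancel]
      linarith
  calc ∫⁻ x in U ∩ Ω, ENNReal.ofReal ((luxNorm Ω p (U.indicator f) / b / l) ^ p x)
      ≤ ∫⁻ _ in U ∩ Ω, ENNReal.ofReal (a ^ q / (c / V * m)) := by
        refine lintegral_mono_ae ?_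
        filter_upwards [hqpr, hlow] with x hx hxlow
        refine ENNReal.ofReal_le_ofReal ?_
        rw [div_right_comm, Real.div_rpow ha₀ hb₀]
        have : a ^ p x ≤ a ^ q :=
          Real.rpow_le_rpow_of_exponent_ge_of_imp ha₀ ha1 hx.1 (fun _ _ => by linarith)
        gcongr
    _ = ENNReal.ofReal (a ^ q / (c / V * m) * m) := by
        rw [setLIntegral_const, ENNReal.ofReal_mul (by positivity), hm,
          ENNReal.ofReal_toReal hfin]
    _ ≤ ENNReal.ofReal (V / c ^ 2 * (R.toReal + m)) := by
        refine ENNReal.ofReal_le_ofReal ?_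
        calc a ^ q / (c / V * m) * m = V / c * a ^ q := by field_simp
          _ ≤ V / c * ((R.toReal + m) / c) := by gcongr
          _ = V / c ^ 2 * (R.toReal + m) := by ring
    _ = ENNReal.ofReal (V / c ^ 2) * (R + volume (U ∩ Ω)) := by
        rw [ENNReal.ofReal_mul (by positivity), ENNReal.ofReal_add hR₀ hpos.le,
          ENNReal.ofReal_toReal hRtop, ENNReal.ofReal_toReal hfin]

end Local

theorem sum_div_rpow_le {ι : Type*} (s : Finset ι) {y : ι → ℝ} (hy : ∀ i ∈ s, 0 ≤ y i)
    {N D p : ℝ} (hN : 1 ≤ N) (hcard : (s.card : ℝ) ≤ N) (hD : 1 ≤ D) (hp : 1 ≤ p) :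
    ((∑ i ∈ s, y i) / (N * D)) ^ p ≤ D⁻¹ * ∑ i ∈ s, y i ^ p := by
  have hsum : 0 ≤ ∑ i ∈ s, y i := Finset.sum_nonneg hy
  have hsum' : 0 ≤ ∑ i ∈ s, y i ^ p := Finset.sum_nonneg fun i hi => Real.rpow_nonneg (hy i hi) p
  have hDp : D ≤ D ^ p := Real.self_le_rpow_of_one_le hD hp
  have hNp : (s.card : ℝ) ^ (p - 1) ≤ N ^ p :=
    (Real.rpow_le_rpow (Nat.cast_nonneg _) hcard (by linarith)).trans
      (Real.rpow_le_rpow_of_exponent_le hN (by linarith))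
  rw [Real.div_rpow hsum (by positivity), Real.mul_rpow (by positivity) (by positivity),
    div_le_iff₀ (by positivity)]
  calc (∑ i ∈ s, y i) ^ p ≤ (s.card : ℝ) ^ (p - 1) * ∑ i ∈ s, y i ^ p :=
        Real.rpow_sum_le_const_mul_sum_rpow_of_nonneg s hp hy
    _ ≤ N ^ p * ∑ i ∈ s, y i ^ p := by gcongr
    _ = D⁻¹ * (∑ i ∈ s, y i ^ p) * (N ^ p * D) := by field_simp
    _ ≤ D⁻¹ * (∑ i ∈ s, y i ^ p) * (N ^ p * D ^ p) := by gcongr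

section Overlap

variable {n : ℕ} {Ω : Set (Eucl n)} (T : WhitneyTreeCovering n Ω)

theorem WhitneyTreeCovering.ae_exists_finset (hΩ : MeasurableSet Ω) :
    ∀ᵐ x ∂(volume.restrict Ω), ∃ S : Finset T.ι, (∀ t, t ∈ S ↔ x ∈ T.U t) ∧
      (S.card : ℝ) ≤ T.C₁ := by
  rw [ae_restrict_iff' hΩ]
  filter_upwards [T.cover] with x hx hxΩ
  obtain ⟨h₁, h₂⟩ := hx
  have h₁ := h₁ hxΩ
  rw [indicator_of_mem hxΩ, mul_one] at h₂
  have hsum : Summable fun t : T.ι => (T.U t).indicator (fun _ => (1 : ℝ)) x := by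
    by_contra hns
    rw [show (∑' t : T.ι, (cubeU (T.kk t) (T.zz t)).indicator (fun _ => (1 : ℝ)) x) = 0 from
      tsum_eq_zero_of_not_summable hns] at h₁
    linarith
  have hfin : {t : T.ι | x ∈ T.U t}.Finite := by
    refine (hsum.tendsto_cofinite_zero.eventually (gt_mem_nhds one_pos)).subset fun t ht => ?_
    simp [indicator_of_mem (show x ∈ T.U t from ht)]
  refine ⟨hfin.toFinset, fun t => by simp, ?_⟩
  calc (hfin.toFinset.card : ℝ)
      = ∑ t ∈ hfin.toFinset, (T.U t).indicator (fun _ => (1 : ℝ)) x := by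
        rw [Finset.sum_congr rfl fun t ht =>
          indicator_of_mem (show x ∈ T.U t by simpa using ht) _]
        simp
    _ ≤ ∑' t, (T.U t).indicator (fun _ => (1 : ℝ)) x :=
        hsum.sum_le_tsum _ fun t _ => indicator_nonneg (fun _ _ => zero_le_one) x
    _ ≤ T.C₁ := h₂

theorem WhitneyTreeCovering.tsum_indicator_eq_sum {β : Type*} [AddCommMonoid β]
    [TopologicalSpace β] {x : Eucl n} {S : Finset T.ι}
    (hS : ∀ t, t ∈ S ↔ x ∈ T.U t) (g : T.ι → Eucl n → β) :
    ∑' t, (T.U t).indicator (g t) x = ∑ t ∈ S, g t x := by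
  rw [tsum_eq_sum fun t ht => indicator_of_notMem (fun h => ht ((hS t).2 h)) _]
  exact Finset.sum_congr rfl fun t ht => indicator_of_mem ((hS t).1 ht) _

theorem WhitneyTreeCovering.lintegral_tsum_indicator {g : T.ι → Eucl n → ENNReal}
    (hg : ∀ t, Measurable (g t)) :
    ∫⁻ x in Ω, ∑' t, (T.U t).indicator (g t) x = ∑' t, ∫⁻ x in T.U t ∩ Ω, g t x := by
  have := T.countable
  rw [lintegral_tsum fun t => ((hg t).indicator (T.measurableSet_U t)).aemeasurable]
  refine tsum_congr fun t => ?_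
  rw [lintegral_indicator (T.measurableSet_U t), Measure.restrict_restrict (T.measurableSet_U t)]

theorem WhitneyTreeCovering.tsum_setLIntegral_le (hΩ : MeasurableSet Ω) {g : Eucl n → ENNReal}
    (hg : Measurable g) :
    ∑' t, ∫⁻ x in T.U t ∩ Ω, g x ≤ ENNReal.ofReal T.C₁ * ∫⁻ x in Ω, g x := by
  rw [← T.lintegral_tsum_indicator fun _ => hg, ← lintegral_const_mul _ hg]
  refine lintegral_mono_ae ?_
  filter_upwards [T.ae_exists_finset hΩ] with x ⟨S, hS, hcard⟩
  rw [T.tsum_indicator_eq_sum hS, Finset.sum_const, nsmul_eq_mul]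
  gcongr
  rw [← ENNReal.ofReal_natCast]
  exact ENNReal.ofReal_le_ofReal hcard

theorem WhitneyTreeCovering.ae_modular_Tp_le (hΩ : MeasurableSet Ω) {p : Eucl n → ℝ}
    (hp1 : ∀ x ∈ Ω, 1 ≤ p x) (f : Eucl n → ℝ) {D l : ℝ} (hD : 1 ≤ D) (hl : 0 < l) :
    ∀ᵐ x ∂(volume.restrict Ω), ENNReal.ofReal ((|Tp T p f x| / (T.C₁ * D * l)) ^ p x) ≤
      ENNReal.ofReal D⁻¹ * ∑' t, (T.U t).indicator (fun x => ENNReal.ofReal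
        ((luxNorm Ω p ((T.U t).indicator f) / luxNorm Ω p (charFun (T.U t)) / l) ^ p x)) x := by
  filter_upwards [T.ae_exists_finset hΩ, ae_restrict_mem hΩ] with x ⟨S, hS, hcard⟩ hxΩ
  have hy (t : T.ι) :
      0 ≤ luxNorm Ω p ((T.U t).indicator f) / luxNorm Ω p (charFun (T.U t)) / l :=
    div_nonneg (div_nonneg (luxNorm_nonneg _ _ _) (luxNorm_nonneg _ _ _)) hl.le
  rw [T.tsum_indicator_eq_sum hS, ← ENNReal.ofReal_sum_of_nonneg
    fun t _ => Real.rpow_nonneg (hy t) _, ← ENNReal.ofReal_mul (by positivity)]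
  refine ENNReal.ofReal_le_ofReal ?_
  refine le_trans (le_of_eq ?_)
    (sum_div_rpow_le S (fun t _ => hy t) T.one_le_C₁ hcard hD (hp1 x hxΩ))
  congr 1
  rw [Tp, T.tsum_indicator_eq_sum hS, ← Finset.sum_div, abs_of_nonneg, div_div, mul_comm l]
  exact Finset.sum_nonneg fun t _ => div_nonneg (luxNorm_nonneg _ _ _) (luxNorm_nonneg _ _ _)

end Overlap

/-- Lemma 4.1, boundedness of `T_{p(·)}` on `L^{p(·)}(Ω)`. -/
theorem Tp_bounded
    (n : ℕ) (Ω : Set (Eucl n)) (hΩo : IsOpen Ω) (hΩc : IsConnected Ω)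
    (hΩb : Bornology.IsBounded Ω) (T : WhitneyTreeCovering n Ω)
    (p : Eucl n → ℝ) (hpm : Measurable p) (hp1 : ∀ x ∈ Ω, 1 ≤ p x)
    (hpb : ∃ M : ℝ, ∀ᵐ x ∂(volume.restrict Ω), p x ≤ M)
    (τ : ℝ) (hτ : 1 ≤ τ) (C₀ : ℝ) (hC₀ : 0 < C₀) (hLH : BoundaryLH Ω p τ C₀) :
    ∃ C : ℝ, ∀ f : Eucl n → ℝ, Measurable f → MemVarLp Ω p f →
      luxNorm Ω p (Tp T p f) ≤ C * luxNorm Ω p f := by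
  obtain ⟨M, hM⟩ := hpb
  have hΩm := hΩo.measurableSet
  have hΩfin : volume Ω ≠ ⊤ := hΩb.measure_lt_top.ne
  obtain ⟨c, hc₀, hc₁, hcov⟩ := T.exists_le_volume_rpow_oscillation hΩo hΩc.nonempty hΩb hp1 hM
    hτ hC₀ hLH
  set V : ℝ := max (volume Ω).toReal 1
  set K : ℝ := V / c ^ 2
  set D : ℝ := max (K * (T.C₁ * (1 + (volume Ω).toReal))) 1
  have hV : 1 ≤ V := le_max_right _ _
  have hD : 1 ≤ D := le_max_right _ _
  have hC₁ : 0 < T.C₁ := one_pos.trans_le T.one_le_C₁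
  have hC : 0 < T.C₁ * D := by positivity
  refine ⟨T.C₁ * D, fun f hf hmem => ?_⟩
  have hscale (l : ℝ) (hl : 0 < l)
      (hmod : ∫⁻ x in Ω, ENNReal.ofReal ((|f x| / l) ^ p x) ≤ 1) :
      luxNorm Ω p (Tp T p f) ≤ T.C₁ * D * l := by
    refine luxNorm_le (by positivity) ?_
    have hlocal (t : T.ι) : ∫⁻ x in T.U t ∩ Ω, ENNReal.ofReal
          ((luxNorm Ω p ((T.U t).indicator f) / luxNorm Ω p (charFun (T.U t)) / l) ^ p x) ≤
        ENNReal.ofReal K *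
          ∫⁻ x in T.U t ∩ Ω, (ENNReal.ofReal ((|f x| / l) ^ p x) + 1) := by
      obtain ⟨q, r, hq, hqr, hqpr, hosc⟩ := hcov t
      have hpos : 0 < (volume (T.U t ∩ Ω)).toReal :=
        lt_of_lt_of_le (by positivity) (T.pow_le_volume hΩfin t)
      have hmV : (volume (T.U t ∩ Ω)).toReal ≤ V :=
        (ENNReal.toReal_mono hΩfin (measure_mono inter_subset_right)).trans (le_max_left _ _)
      rw [lintegral_add_right _ measurable_const, setLIntegral_one]
      exact setLIntegral_luxNorm_ratio_rpow_le hΩm (T.measurableSet_U t) hp1 hpos hV hmV hc₀ hc₁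
        hq hqr hqpr hosc hl ((lintegral_mono_set inter_subset_right).trans hmod)
    calc ∫⁻ x in Ω, ENNReal.ofReal ((|Tp T p f x| / (T.C₁ * D * l)) ^ p x)
        ≤ ∫⁻ x in Ω, ENNReal.ofReal D⁻¹ * ∑' t, (T.U t).indicator (fun x => ENNReal.ofReal
            ((luxNorm Ω p ((T.U t).indicator f) / luxNorm Ω p (charFun (T.U t)) / l) ^ p x)) x :=
          lintegral_mono_ae (T.ae_modular_Tp_le hΩm hp1 f hD hl)
      _ = ENNReal.ofReal D⁻¹ * ∑' t, ∫⁻ x in T.U t ∩ Ω, ENNReal.ofReal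
            ((luxNorm Ω p ((T.U t).indicator f) / luxNorm Ω p (charFun (T.U t)) / l) ^ p x) := by
          rw [lintegral_const_mul' _ _ ENNReal.ofReal_ne_top,
            T.lintegral_tsum_indicator fun t => by fun_prop]
      _ ≤ ENNReal.ofReal D⁻¹ * ∑' t, ENNReal.ofReal K *
            ∫⁻ x in T.U t ∩ Ω, (ENNReal.ofReal ((|f x| / l) ^ p x) + 1) := by
          gcongr with t
          exact hlocal t
      _ ≤ ENNReal.ofReal D⁻¹ * (ENNReal.ofReal K * (ENNReal.ofReal T.C₁ *
            ∫⁻ x in Ω, (ENNReal.ofReal ((|f x| / l) ^ p x) + 1))) := by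
          rw [ENNReal.tsum_mul_left]
          gcongr
          exact T.tsum_setLIntegral_le hΩm (by fun_prop)
      _ ≤ ENNReal.ofReal D⁻¹ * (ENNReal.ofReal K * (ENNReal.ofReal T.C₁ *
            (1 + volume Ω))) := by
          rw [lintegral_add_right _ measurable_const, setLIntegral_one]
          gcongr
      _ = ENNReal.ofReal (D⁻¹ * (K * (T.C₁ * (1 + (volume Ω).toReal)))) := by
          rw [ENNReal.ofReal_mul (by positivity), ENNReal.ofReal_mul (by positivity),
            ENNReal.ofReal_mul hC₁.le, ENNReal.ofReal_add zero_le_one ENNReal.toReal_nonneg,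
            ENNReal.ofReal_one, ENNReal.ofReal_toReal hΩfin]
      _ ≤ 1 := by
          rw [ENNReal.ofReal_le_one, inv_mul_le_iff₀ (by positivity), mul_one]
          exact le_max_left _ _
  rw [mul_comm, ← div_le_iff₀ hC]
  refine le_csInf hmem fun l hl => ?_
  rw [div_le_iff₀ hC, mul_comm]
  exact hscale l hl.1 hl.2
end
end
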